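/- arXiv:2403.17658 — 13 statements merged into one kernel-verified Lean document; each statement's English description precedes it below -/
import Mathlib

section
/- Let G be a finite simple graph with vertex set V and let w be any permutation of V (viewed as a word listing each vertex exactly once). Then the word ww (the concatenation of w with itself) fixes the MIS network of G; that is, for every configuration x ∈ {0,1}^V, the configuration MIS^{ww}(x) is the characteristic vector of a maximal independent set of G. -/
variable {V : Type*}

/-- One sequential update of the MIS network at vertex `v`:
the state of `v` becomes `1` iff all its neighbours are in state `0`. -/
def misStep [DecidableEq V] (G : SimpleGraph V) (x : V → Prop) (v : V) : V → Prop :=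
  Function.update x v (∀ u, G.Adj u v → ¬ x u)

/-- Sequential updates of the MIS network along the word `w` (first letter updated first). -/
def misWord [DecidableEq V] (G : SimpleGraph V) (w : List V) (x : V → Prop) : V → Prop :=
  w.foldl (misStep G) x

/-- `S` is an independent set of `G`. -/
def IsIndepSet {W : Type*} (G : SimpleGraph W) (S : Set W) : Prop :=
  ∀ ⦃u⦄, u ∈ S → ∀ ⦃v⦄, v ∈ S → ¬ G.Adj u v

/-- `S` is a maximal independent set of `G`. -/
def IsMaxIndepSet {W : Type*} (G : SimpleGraph W) (S : Set W) : Prop :=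
  IsIndepSet G S ∧ ∀ T, IsIndepSet G T → S ⊆ T → T = S

theorem misWord_indep [DecidableEq V] (G : SimpleGraph V) (w : List V) :
    ∀ (x : V → Prop) (S : Set V),
      (∀ u ∈ S, ∀ v ∈ S, x u → x v → ¬ G.Adj u v) →
      ∀ u v, (u ∈ S ∨ u ∈ w) → (v ∈ S ∨ v ∈ w) →
        misWord G w x u → misWord G w x v → ¬ G.Adj u v := by
  induction w with
  | nil =>
    intro x S h u v hu hv
    simp only [List.not_mem_nil, or_false] at hu hv
    exact h u hu v hv
  | cons a w ih =>
    intro x S h u v hu hv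
    refine ih (misStep G x a) (insert a S) ?_ u v ?_ ?_
    · intro u hu v hv hxu hxv hadj
      have hne := hadj.ne
      by_cases hua : u = a
      · subst hua
        have hva : v ≠ u := hne.symm
        simp only [misStep, Function.update_self, Function.update_of_ne hva] at hxu hxv
        exact hxu v hadj.symm hxv
      · by_cases hva : v = a
        · subst hva
          simp only [misStep, Function.update_self, Function.update_of_ne hua] at hxu hxv
          exact hxv u hadj hxu
        · simp only [misStep, Function.update_of_ne hva, Function.update_of_ne hua] at hxu hxv
          exact h u (hu.resolve_left hua) v (hv.resolve_left hva) hxu hxv hadj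
    · simp only [Set.mem_insert_iff, List.mem_cons] at *; tauto
    · simp only [Set.mem_insert_iff, List.mem_cons] at *; tauto

theorem misWord_dom [DecidableEq V] (G : SimpleGraph V) (w : List V) :
    ∀ (x : V → Prop), (∀ u v, x u → x v → ¬ G.Adj u v) →
      (∀ v, x v → misWord G w x v) ∧
      ∀ v ∈ w, misWord G w x v ∨ ∃ u, G.Adj u v ∧ misWord G w x u := by
  induction w with
  | nil => intro x _; exact ⟨fun v h => h, by simp⟩
  | cons a w ih =>
    intro x h
    have hmono : ∀ v, x v → misStep G x a v := by
      intro v hv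
      by_cases hva : v = a
      · subst hva
        simp only [misStep, Function.update_self]
        exact fun u hu hxu => h u v hxu hv hu
      · simpa only [misStep, Function.update_of_ne hva] using hv
    have hind : ∀ u v, misStep G x a u → misStep G x a v → ¬ G.Adj u v := by
      intro u v
      exact misWord_indep G [a] x Set.univ (fun u _ v _ => h u v) u v
        (Or.inl trivial) (Or.inl trivial)
    obtain ⟨h1, h2⟩ := ih _ hind
    refine ⟨fun v hv => h1 v (hmono v hv), fun v hv => ?_⟩
    rcases List.mem_cons.1 hv with rfl | hv
    · by_cases hn : ∀ u, G.Adj u v → ¬ x u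
      · left
        apply h1
        simpa only [misStep, Function.update_self] using hn
      · right
        push Not at hn
        obtain ⟨u, hu, hxu⟩ := hn
        exact ⟨u, hu, h1 u (hmono u hxu)⟩
    · exact h2 v hv

/-- For any permutation `w` of the vertex set of a finite graph `G`, the word `ww`
fixes the MIS network: from any configuration `x`, `MIS^{ww}(x)` is the characteristic
vector (here: characteristic set) of a maximal independent set of `G`. -/
theorem stmt_0 [DecidableEq V] [Fintype V] (G : SimpleGraph V)
    (w : List V) (hnodup : w.Nodup) (hall : ∀ v : V, v ∈ w)
    (x : V → Prop) :
    IsMaxIndepSet G {v | misWord G (w ++ w) x v} := by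
  have happ : misWord G (w ++ w) x = misWord G w (misWord G w x) := by
    simp [misWord, List.foldl_append]
  rw [happ]
  have hind : ∀ (x : V → Prop) u v, misWord G w x u → misWord G w x v → ¬ G.Adj u v :=
    fun x u v => misWord_indep G w x ∅ (by simp) u v (Or.inr (hall u)) (Or.inr (hall v))
  obtain ⟨_, h2⟩ := misWord_dom G w (misWord G w x) (hind x)
  refine ⟨fun u hu v hv => hind _ u v hu hv, fun T hT hST => ?_⟩
  refine Set.Subset.antisymm (fun v hv => ?_) hST
  rcases h2 v (hall v) with h | ⟨u, hadj, hu⟩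
  · exact h
  · exact absurd hadj (hT (hST hu) hv)
end

section
/- Let G = (V,E) be a finite simple graph and x, y two configurations. The following are equivalent: (1) y is reachable from x under the MIS network, i.e. y = MIS^w(x) for some word w; (2) there is an MIS-geodesic from x to y; (3) every edge of the subgraph of G induced on one(y) is an edge of the subgraph induced on one(x), and for every connected component C of the subgraph induced on one(x), y is not identically zero on C. -/
variable {V : Type*}

theorem misWord_geo [DecidableEq V] [Fintype V] (G : SimpleGraph V) (y : V → Prop) (d : V → ℕ) :
    ∀ (n : ℕ) (x : V → Prop), Set.ncard {v | ¬ (x v ↔ y v)} = n →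
      (∀ u v, G.Adj u v → y u → y v → (x u ∧ x v)) →
      (∀ v, x v → ¬ y v → ∃ u, G.Adj u v ∧ x u ∧ d u < d v) →
      ∃ w : List V, w.Nodup ∧ misWord G w x = y ∧ ∀ v, v ∈ w ↔ ¬(x v ↔ y v) := by
  intro n
  induction n with
  | zero =>
    intro x hn _ _
    have h0 : {v | ¬ (x v ↔ y v)} = ∅ := (Set.ncard_eq_zero (Set.toFinite _)).1 hn
    have h1 : ∀ v, x v ↔ y v := by
      intro v
      by_contra h
      have : v ∈ {v | ¬ (x v ↔ y v)} := h
      rw [h0] at this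
      exact this
    refine ⟨[], List.nodup_nil, ?_, ?_⟩
    · funext v
      exact propext (h1 v)
    · intro v
      simp [h1 v]
  | succ n ih =>
    intro x hn he hd
    -- it suffices to find a good vertex to flip
    suffices H : ∃ v, ¬ (x v ↔ y v) ∧ (misStep G x v v ↔ y v) ∧
        (∀ a b, G.Adj a b → y a → y b → (misStep G x v a ∧ misStep G x v b)) ∧
        (∀ a, misStep G x v a → ¬ y a → ∃ u, G.Adj u a ∧ misStep G x v u ∧ d u < d a) by
      obtain ⟨v, hv, hvy, he', hd'⟩ := H
      have hne : ∀ a, a ≠ v → misStep G x v a = x a := fun a ha => by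
        simp [misStep, ha]
      have hset : {a | ¬ (misStep G x v a ↔ y a)} = {a | ¬ (x a ↔ y a)} \ {v} := by
        ext a
        by_cases ha : a = v
        · subst ha
          simp [hvy]
        · simp [hne a ha, ha]
      have hc : Set.ncard {a | ¬ (misStep G x v a ↔ y a)} = n := by
        rw [hset, Set.ncard_sdiff_singleton_of_mem (by exact hv), hn]
        rfl
      obtain ⟨w, hw, hwy, hm⟩ := ih _ hc he' hd'
      refine ⟨v :: w, ?_, ?_, ?_⟩
      · rw [List.nodup_cons]
        exact ⟨fun h => (hm v).1 h hvy, hw⟩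
      · exact hwy
      · intro a
        rw [List.mem_cons]
        by_cases ha : a = v
        · subst ha
          simp [hv]
        · rw [hm a, hne a ha]
          simp [ha]
    by_cases hdown : ∃ v, x v ∧ ¬ y v
    · obtain ⟨v, ⟨hxv, hyv⟩, hmax⟩ := Set.exists_max_image {v | x v ∧ ¬ y v} d
        (Set.toFinite _) hdown
      have hne : ∀ a, a ≠ v → misStep G x v a = x a := fun a ha => by
        simp [misStep, ha]
      obtain ⟨u, huv, hxu, hdu⟩ := hd v hxv hyv
      have hvv : ¬ misStep G x v v := by
        simp only [misStep, Function.update_self]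
        intro h
        exact h u huv hxu
      refine ⟨v, fun h => hyv (h.1 hxv), by simp [hvv, hyv], ?_, ?_⟩
      · intro a b hab ha hb
        rw [hne a (by rintro rfl; exact hyv ha), hne b (by rintro rfl; exact hyv hb)]
        exact he a b hab ha hb
      · intro a ha hya
        have hav : a ≠ v := by
          rintro rfl
          exact hvv ha
        rw [hne a hav] at ha
        obtain ⟨t, hta, hxt, hdt⟩ := hd a ha hya
        have htv : t ≠ v := by
          rintro rfl
          have := hmax a ⟨ha, hya⟩
          omega
        exact ⟨t, hta, by rw [hne t htv]; exact hxt, hdt⟩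
    · push Not at hdown
      have hnon : {v | ¬ (x v ↔ y v)}.Nonempty := by
        apply Set.nonempty_of_ncard_ne_zero
        omega
      obtain ⟨v, hv⟩ := hnon
      have hv : ¬ (x v ↔ y v) := hv
      have hxv : ¬ x v := fun h => hv ⟨fun _ => hdown v h, fun _ => h⟩
      have hyv : y v := by
        by_contra h
        exact hv ⟨fun h' => absurd h' hxv, fun h' => absurd h' h⟩
      have hne : ∀ a, a ≠ v → misStep G x v a = x a := fun a ha => by
        simp [misStep, ha]
      have hvv : misStep G x v v := by
        simp only [misStep, Function.update_self]
        intro u huv hxu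
        exact hxv (he u v huv (hdown u hxu) hyv).2
      have hle : ∀ a, x a → misStep G x v a := by
        intro a ha
        rw [hne a (by rintro rfl; exact hxv ha)]
        exact ha
      refine ⟨v, hv, by simp [hvv, hyv], ?_, ?_⟩
      · intro a b hab ha hb
        exact ⟨hle a (he a b hab ha hb).1, hle b (he a b hab ha hb).2⟩
      · intro a ha hya
        have hav : a ≠ v := by
          rintro rfl
          exact hya hyv
        rw [hne a hav] at ha
        exact absurd (hdown a ha) hya

theorem misWord_inv [DecidableEq V] (G : SimpleGraph V) (x : V → Prop) (w : List V) :
    ∀ z : V → Prop,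
      ((∀ u v, G.Adj u v → z u → z v → (x u ∧ x v)) ∧
        ∀ C : (G.induce {v | x v}).ConnectedComponent,
          ∃ u : {v | x v}, (G.induce {v | x v}).connectedComponentMk u = C ∧ z u.1) →
      ((∀ u v, G.Adj u v → misWord G w z u → misWord G w z v → (x u ∧ x v)) ∧
        ∀ C : (G.induce {v | x v}).ConnectedComponent,
          ∃ u : {v | x v}, (G.induce {v | x v}).connectedComponentMk u = C ∧
            misWord G w z u.1) := by
  induction w with
  | nil => exact fun z h => h
  | cons v w ih =>
    rintro z ⟨he, hC⟩
    refine ih (misStep G z v) ?_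
    have hne : ∀ a, a ≠ v → misStep G z v a = z a := fun a ha => by
      simp [misStep, ha]
    have hself : misStep G z v v ↔ ∀ u, G.Adj u v → ¬ z u := by
      simp [misStep]
    constructor
    · intro a b hab ha hb
      by_cases hav : a = v
      · subst hav
        rw [hne b hab.ne'] at hb
        exact absurd hb (hself.1 ha b hab.symm)
      · by_cases hbv : b = v
        · subst hbv
          rw [hne a hav] at ha
          exact absurd ha (hself.1 hb a hab)
        · rw [hne a hav] at ha
          rw [hne b hbv] at hb
          exact he a b hab ha hb
    · intro C
      obtain ⟨⟨a, hxa⟩, haC, hza⟩ := hC C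
      by_cases hs : misStep G z v a
      · exact ⟨⟨a, hxa⟩, haC, hs⟩
      · have hav : a = v := by
          by_contra h
          rw [hne a h] at hs
          exact hs hza
        subst hav
        rw [hself] at hs
        push Not at hs
        obtain ⟨u, hua, hzu⟩ := hs
        have hxu : x u := (he u a hua hzu hza).1
        refine ⟨⟨u, hxu⟩, ?_, ?_⟩
        · rw [← haC]
          apply SimpleGraph.ConnectedComponent.connectedComponentMk_eq_of_adj
          exact hua
        · show misStep G z a u
          rw [hne u hua.ne]
          exact hzu

/-- Reachability for the MIS network: `y` is reachable from `x`, iff there is an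
MIS-geodesic from `x` to `y` (a word without repeated letters visiting exactly the
vertices where `x` and `y` differ), iff every edge of the subgraph induced on the
support of `y` is an edge of the subgraph induced on the support of `x` and `y` is
not identically zero on any connected component of the subgraph induced on the
support of `x`. -/
theorem stmt_2 [DecidableEq V] [Fintype V] (G : SimpleGraph V) (x y : V → Prop) :
    List.TFAE [
      ∃ w : List V, misWord G w x = y,
      ∃ w : List V, w.Nodup ∧ misWord G w x = y ∧ ∀ v, v ∈ w ↔ ¬(x v ↔ y v),
      (∀ u v, G.Adj u v → y u → y v → (x u ∧ x v)) ∧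
        ∀ C : (G.induce {v | x v}).ConnectedComponent,
          ∃ u : {v | x v}, (G.induce {v | x v}).connectedComponentMk u = C ∧ y u.1
    ] := by
  tfae_have 2 → 1 := by
    rintro ⟨w, _, h, _⟩
    exact ⟨w, h⟩
  tfae_have 1 → 3 := by
    rintro ⟨w, rfl⟩
    refine misWord_inv G x w x ⟨fun u v _ hu hv => ⟨hu, hv⟩, fun C => ?_⟩
    induction C using SimpleGraph.ConnectedComponent.ind with
    | h u => exact ⟨u, rfl, u.2⟩
  tfae_have 3 → 2 := by
    rintro ⟨he, hC⟩
    let S : V → Set ℕ := fun v => {n | ∃ (hv : x v) (u : {v | x v}), y u.1 ∧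
      ∃ p : (G.induce {v | x v}).Walk ⟨v, hv⟩ u, p.length = n}
    refine misWord_geo G y (fun v => sInf (S v)) _ x rfl he ?_
    intro v hv hyv
    have hne : (S v).Nonempty := by
      obtain ⟨u, hu, hyu⟩ := hC ((G.induce {v | x v}).connectedComponentMk ⟨v, hv⟩)
      obtain ⟨p⟩ := SimpleGraph.ConnectedComponent.exact hu.symm
      exact ⟨p.length, hv, u, hyu, p, rfl⟩
    obtain ⟨_, u, hyu, p, hp⟩ := Nat.sInf_mem hne
    cases p with
    | nil => exact absurd hyu hyv
    | @cons _ t _ hadj q =>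
      refine ⟨t.1, ?_, t.2, ?_⟩
      · exact SimpleGraph.Adj.symm hadj
      · have : sInf (S t.1) ≤ q.length := Nat.sInf_le ⟨t.2, u, hyu, q, rfl⟩
        rw [SimpleGraph.Walk.length_cons] at hp
        show sInf (S t.1) < sInf (S v)
        omega
  tfae_finish
end

section
/- Let G = (V,E) be a finite simple graph and x a configuration. Then x is MIS(G)-universal (every fixed point of MIS(G) is reachable from x by sequential updates) if and only if every connected component C of the subgraph of G induced on one(x) is a non-constituency of G, i.e. there is no independent set I of G with C ⊆ N(I). -/
variable {V : Type*}

/-- `S` is a constituency of `H`: some independent set `I` dominates `S`,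
i.e. `S ⊆ N(I)`. -/
def Constituency {W : Type*} (H : SimpleGraph W) (S : Set W) : Prop :=
  ∃ I : Set W, IsIndepSet H I ∧ S ⊆ {v | ∃ i ∈ I, H.Adj i v}

theorem mis_reach_step [DecidableEq V] (G : SimpleGraph V) (z y : V → Prop) (v : V)
    (h : ∃ w : List V, misWord G w (misStep G z v) = y) : ∃ w : List V, misWord G w z = y := by
  obtain ⟨w, hw⟩ := h
  exact ⟨v :: w, hw⟩

/-- Phase 2: from a subset of a fixed point one reaches the fixed point. -/
theorem mis_phase_two [DecidableEq V] [Fintype V] (G : SimpleGraph V) (y : V → Prop)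
    (hy : ∀ v, y v ↔ ∀ u, G.Adj u v → ¬ y u) :
    ∀ (n : ℕ) (z : V → Prop), (∀ v, z v → y v) → {v | y v ∧ ¬ z v}.ncard = n →
      ∃ w : List V, misWord G w z = y := by
  intro n
  induction n using Nat.strong_induction_on with
  | _ n ih =>
    intro z hz hn
    by_cases hex : ∃ v, y v ∧ ¬ z v
    · obtain ⟨v, hyv, hzv⟩ := hex
      have hv : ∀ u, G.Adj u v → ¬ z u := fun u hu h => (hy v).1 hyv u hu (hz u h)
      have e : ∀ a, misStep G z v a ↔ (a = v ∨ z a) := by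
        intro a
        by_cases ha : a = v
        · subst ha; simp [misStep]; exact hv
        · simp [misStep, ha]
      apply mis_reach_step G z y v
      refine ih _ ?_ _ ?_ rfl
      · rw [← hn]
        apply Set.ncard_lt_ncard _ (Set.toFinite _)
        rw [Set.ssubset_iff_of_subset]
        · exact ⟨v, ⟨hyv, hzv⟩, fun h => h.2 ((e v).2 (Or.inl rfl))⟩
        · rintro a ⟨h1, h2⟩
          exact ⟨h1, fun h => h2 ((e a).2 (Or.inr h))⟩
      · intro a ha
        rcases (e a).1 ha with h | h
        · exact h ▸ hyv
        · exact hz a h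
    · refine ⟨[], ?_⟩
      funext a
      apply propext
      refine ⟨hz a, fun h => ?_⟩
      by_contra h'
      exact hex ⟨a, h, h'⟩

/-- Phase 1: remove the vertices outside the fixed point, farthest first. -/
theorem mis_phase_one [DecidableEq V] [Fintype V] (G : SimpleGraph V) (y : V → Prop)
    (hy : ∀ v, y v ↔ ∀ u, G.Adj u v → ¬ y u) (d : V → ℕ) :
    ∀ (n : ℕ) (z : V → Prop),
      (∀ v, z v → ¬ y v → ∃ u, G.Adj u v ∧ z u ∧ d u < d v) → {v | z v ∧ ¬ y v}.ncard = n →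
      ∃ w : List V, misWord G w z = y := by
  intro n
  induction n using Nat.strong_induction_on with
  | _ n ih =>
    intro z hz hn
    by_cases hex : ({v | z v ∧ ¬ y v} : Set V).Nonempty
    · obtain ⟨v, ⟨hzv, hyv⟩, hmax⟩ :=
        Set.exists_max_image {v | z v ∧ ¬ y v} d (Set.toFinite _) hex
      obtain ⟨u, huv, hzu, hdu⟩ := hz v hzv hyv
      have e : ∀ a, misStep G z v a ↔ (a ≠ v ∧ z a) := by
        intro a
        by_cases ha : a = v
        · subst ha; simp [misStep]; exact ⟨u, huv, hzu⟩
        · simp [misStep, ha]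
      apply mis_reach_step G z y v
      refine ih _ ?_ _ ?_ rfl
      · rw [← hn]
        apply Set.ncard_lt_ncard _ (Set.toFinite _)
        rw [Set.ssubset_iff_of_subset]
        · exact ⟨v, ⟨hzv, hyv⟩, fun h => ((e v).1 h.1).1 rfl⟩
        · rintro a ⟨h1, h2⟩
          exact ⟨((e a).1 h1).2, h2⟩
      · intro a ha hya
        have hza := ((e a).1 ha).2
        obtain ⟨b, hb, hzb, hdb⟩ := hz a hza hya
        refine ⟨b, hb, (e b).2 ⟨?_, hzb⟩, hdb⟩
        rintro rfl
        exact absurd (hmax a ⟨hza, hya⟩) (by omega)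
    · apply mis_phase_two G y hy _ z _ rfl
      intro a ha
      by_contra h
      exact hex ⟨a, ha, h⟩

theorem mis_invariant [DecidableEq V] (G : SimpleGraph V) (x : V → Prop) (S : Set V)
    (hS : ∀ u v, G.Adj u v → x u → v ∈ S → u ∈ S) :
    ∀ (w : List V) (z : V → Prop), (∀ u v, G.Adj u v → z u → z v → x u) →
      (∃ c ∈ S, z c) → ∃ c ∈ S, misWord G w z c := by
  intro w
  induction w with
  | nil => intro z _ h; exact h
  | cons v w ih =>
    intro z hz hc
    apply ih (misStep G z v)
    · intro a b hab ha hb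
      by_cases hav : a = v
      · subst hav
        have hba : b ≠ a := hab.ne'
        simp [misStep, hba] at ha hb
        exact absurd hb (ha b hab.symm)
      · by_cases hbv : b = v
        · subst hbv
          simp [misStep, hav] at ha hb
          exact absurd ha (hb a hab)
        · simp [misStep, hav, hbv] at ha hb
          exact hz a b hab ha hb
    · obtain ⟨c, hcS, hzc⟩ := hc
      by_cases hcv : c = v
      · subst hcv
        by_cases hall : ∀ u, G.Adj u c → ¬ z u
        · exact ⟨c, hcS, by simp [misStep]; exact hall⟩
        · push Not at hall
          obtain ⟨u, huc, hzu⟩ := hall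
          refine ⟨u, hS u c huc (hz u c huc hzu hzc) hcS, ?_⟩
          have := huc.ne
          simp [misStep, this, hzu]
      · exact ⟨c, hcS, by simp [misStep, hcv, hzc]⟩

theorem mis_extend [Fintype V] (G : SimpleGraph V) (I : Set V) (hI : IsIndepSet G I) :
    ∃ y : V → Prop, (∀ v, y v ↔ ∀ u, G.Adj u v → ¬ y u) ∧ ∀ v ∈ I, y v := by
  obtain ⟨M, hIM, hM, hmax⟩ :=
    Set.Finite.exists_le_maximal (s := {S : Set V | IsIndepSet G S}) (Set.toFinite _) hI
  refine ⟨fun v => v ∈ M, fun v => ⟨fun hv u huv hu => hM hu hv huv, fun h => ?_⟩,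
    fun v hv => hIM hv⟩
  have : IsIndepSet G (insert v M) := by
    rintro a (rfl | ha) b (rfl | hb) hab
    · exact G.irrefl hab
    · exact h b hab.symm hb
    · exact h a hab ha
    · exact hM ha hb hab
  exact hmax this (Set.subset_insert v M) (Set.mem_insert v M)

/-- A configuration `x` is `MIS(G)`-universal (every fixed point of the MIS network is
reachable from `x` by sequential updates) iff every connected component of the subgraph
induced on the support of `x` is a non-constituency of `G`. -/
theorem stmt_3 [DecidableEq V] [Fintype V] (G : SimpleGraph V) (x : V → Prop) :
    (∀ y : V → Prop, (∀ v, y v ↔ ∀ u, G.Adj u v → ¬ y u) →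
        ∃ w : List V, misWord G w x = y) ↔
    (∀ C : (G.induce {v | x v}).ConnectedComponent,
        ¬ Constituency G {v : V | ∃ h : v ∈ {v | x v},
            (G.induce {v | x v}).connectedComponentMk ⟨v, h⟩ = C}) := by
  constructor
  · rintro h C ⟨I, hI, hCI⟩
    obtain ⟨y, hy, hIy⟩ := mis_extend G I hI
    obtain ⟨w, hw⟩ := h y hy
    obtain ⟨c, hc, hyc⟩ := mis_invariant G x {v : V | ∃ h : v ∈ {v | x v},
            (G.induce {v | x v}).connectedComponentMk ⟨v, h⟩ = C} (by
        rintro u v huv hu ⟨hv, rfl⟩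
        refine ⟨hu, ?_⟩
        apply SimpleGraph.ConnectedComponent.sound
        apply SimpleGraph.Adj.reachable
        simpa using huv) w x (fun u v _ hu _ => hu) (by
        obtain ⟨⟨v, hv⟩, rfl⟩ := C.exists_rep
        exact ⟨v, ⟨hv, rfl⟩, hv⟩)
    rw [hw] at hyc
    obtain ⟨i, hi, hic⟩ := hCI hc
    exact (hy c).1 hyc i hic (hIy i hi)
  · intro h y hy
    have key : ∀ v : {v | x v}, ∃ n : ℕ, ∃ u : {v | x v}, y u ∧
        ∃ p : (G.induce {v | x v}).Walk v u, p.length = n := by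
      intro v
      by_contra hcon
      apply h ((G.induce {v | x v}).connectedComponentMk v)
      refine ⟨{v | y v}, fun a ha b hb hab => (hy b).1 hb a hab ha, ?_⟩
      rintro a ⟨ha, hav⟩
      have hya : ¬ y a := by
        intro hya
        obtain ⟨p⟩ := SimpleGraph.ConnectedComponent.exact hav.symm
        exact hcon ⟨_, ⟨a, ha⟩, hya, p, rfl⟩
      rw [hy a] at hya
      push Not at hya
      obtain ⟨u, hu, hyu⟩ := hya
      exact ⟨u, hyu, hu⟩
    classical
    let d : V → ℕ := fun v => if hv : x v then Nat.find (key ⟨v, hv⟩) else 0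
    refine mis_phase_one G y hy d _ x ?_ rfl
    intro v hv hyv
    obtain ⟨t, hyt, p, hp⟩ := Nat.find_spec (key ⟨v, hv⟩)
    cases p with
    | nil => exact absurd hyt hyv
    | @cons _ b _ hab q =>
      obtain ⟨b, hb⟩ := b
      have hb' : x b := hb
      refine ⟨b, ?_, hb, ?_⟩
      · have : G.Adj v b := by simpa using hab
        exact this.symm
      · have h1 : Nat.find (key ⟨b, hb⟩) ≤ q.length := Nat.find_min' _ ⟨t, hyt, q, rfl⟩
        simp only [d, dif_pos hb', dif_pos hv]
        rw [← hp, SimpleGraph.Walk.length_cons]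
        exact Nat.lt_succ_of_le h1
end

section
/- Let G = (V,E) be a finite simple graph. For every configuration x ∈ {0,1}^V, there exists a maximal independent set M of G such that the characteristic vector y of M is reachable from x by an MIS-geodesic. -/
variable {V : Type*}

theorem misWord_remove [DecidableEq V] (G : SimpleGraph V) (l : List V) :
    ∀ z : V → Prop, (∀ v ∈ l, ∃ u, G.Adj u v ∧ z u ∧ u ∉ l) →
      misWord G l z = fun v => z v ∧ v ∉ l := by
  induction l with
  | nil => intro z _; funext v; simp [misWord]
  | cons a l ih =>
    intro z h
    have hs : misStep G z a = fun v => z v ∧ v ≠ a := by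
      obtain ⟨u, hu, hz, _⟩ := h a (by simp)
      funext v
      by_cases hv : v = a
      · subst hv
        simp only [misStep, Function.update_self, ne_eq, not_true_eq_false, and_false,
          eq_iff_iff, iff_false]
        intro h'
        exact h' u hu hz
      · simp [misStep, hv]
    have : misWord G (a :: l) z = misWord G l (misStep G z a) := rfl
    rw [this, hs, ih]
    · funext v
      simp only [List.mem_cons, eq_iff_iff]
      tauto
    · intro v hv
      obtain ⟨u, hu, hz, hn⟩ := h v (by simp [hv])
      simp only [List.mem_cons, not_or] at hn
      exact ⟨u, hu, ⟨hz, hn.1⟩, hn.2⟩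

theorem misWord_add [DecidableEq V] (G : SimpleGraph V) (l : List V) :
    ∀ z : V → Prop, (∀ v ∈ l, ∀ u, G.Adj u v → ¬ z u ∧ u ∉ l) →
      misWord G l z = fun v => z v ∨ v ∈ l := by
  induction l with
  | nil => intro z _; funext v; simp [misWord]
  | cons a l ih =>
    intro z h
    have hs : misStep G z a = fun v => z v ∨ v = a := by
      funext v
      by_cases hv : v = a
      · subst hv
        simp only [misStep, Function.update_self, or_true, eq_iff_iff, iff_true]
        intro u hu
        exact (h v (by simp) u hu).1
      · simp [misStep, hv]
    have : misWord G (a :: l) z = misWord G l (misStep G z a) := rfl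
    rw [this, hs, ih]
    · funext v
      simp only [List.mem_cons, eq_iff_iff]
      tauto
    · intro v hv u hu
      have := h v (by simp [hv]) u hu
      simp only [List.mem_cons, not_or] at this
      tauto

/-- From every configuration `x`, some maximal independent set `M` of `G` is reachable
by an MIS-geodesic: a word `w` without repeated letters such that `MIS^w(x)` is the
characteristic vector of `M` and `w` visits exactly the vertices where `x` and the
characteristic vector of `M` differ. -/
theorem stmt_4 [DecidableEq V] [Fintype V] (G : SimpleGraph V) (x : V → Prop) :
    ∃ (M : Set V) (w : List V), IsMaxIndepSet G M ∧ w.Nodup ∧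
      (misWord G w x = fun v => v ∈ M) ∧ (∀ v, v ∈ w ↔ ¬(x v ↔ v ∈ M)) := by
  classical
  -- `A` is a maximal independent subset of `{v | x v}`, `M ⊇ A` maximal independent in `G`
  obtain ⟨A, -, hA⟩ := (Set.toFinite {S : Set V | IsIndepSet G S ∧ ∀ v ∈ S, x v}).exists_le_maximal
    (a := (∅ : Set V)) ⟨fun u hu => hu.elim, fun v hv => hv.elim⟩
  obtain ⟨M, hAM, hM⟩ := (Set.toFinite {S : Set V | IsIndepSet G S}).exists_le_maximal
    (a := A) hA.prop.1
  have hMi : IsIndepSet G M := hM.prop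
  have hMA : ∀ v, v ∈ M → x v → v ∈ A := by
    intro v hv hx
    have h1 : M ∩ {v | x v} ⊆ A := hA.le_of_ge
      (y := M ∩ {v | x v}) ⟨fun u hu v hv => hMi hu.1 hv.1, fun v hv => hv.2⟩
      (fun u hu => ⟨hAM hu, hA.prop.2 u hu⟩)
    exact h1 ⟨hv, hx⟩
  have hdom : ∀ v, x v → v ∉ M → ∃ u, G.Adj u v ∧ u ∈ A := by
    intro v hx hv
    by_contra hcon
    push Not at hcon
    have h1 : insert v A ⊆ A := hA.le_of_ge (y := insert v A) ⟨?_, ?_⟩ (Set.subset_insert v A)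
    · exact hv (hAM (h1 (Set.mem_insert v A)))
    · rintro a (rfl | ha) b (rfl | hb) hab
      · exact G.irrefl hab
      · exact hcon b hab.symm hb
      · exact hcon a hab ha
      · exact hA.prop.1 ha hb hab
    · rintro a (rfl | ha)
      · exact hx
      · exact hA.prop.2 a ha
  let l1 : List V := (Finset.univ.filter fun v => x v ∧ v ∉ M).toList
  let l2 : List V := (Finset.univ.filter fun v => ¬ x v ∧ v ∈ M).toList
  have m1 : ∀ v, v ∈ l1 ↔ x v ∧ v ∉ M := by simp [l1]
  have m2 : ∀ v, v ∈ l2 ↔ ¬ x v ∧ v ∈ M := by simp [l2]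
  refine ⟨M, l1 ++ l2, ⟨hMi, fun T hT hMT => ?_⟩, ?_, ?_, ?_⟩
  · exact Set.Subset.antisymm (hM.le_of_ge (y := T) hT hMT) hMT
  · refine List.Nodup.append (Finset.nodup_toList _) (Finset.nodup_toList _) ?_
    intro v h1 h2
    exact ((m2 v).1 h2).1 ((m1 v).1 h1).1
  · have happ : misWord G (l1 ++ l2) x = misWord G l2 (misWord G l1 x) := by
      simp [misWord, List.foldl_append]
    rw [happ, misWord_remove G l1, misWord_add G l2]
    · funext v
      simp only [m1, m2, eq_iff_iff]
      tauto
    · intro v hv u hu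
      have hu' : u ∉ M := fun h => hMi h ((m2 v).1 hv).2 hu
      simp only [m1, m2]
      tauto
    · intro v hv
      obtain ⟨u, hu, huA⟩ := hdom v ((m1 v).1 hv).1 ((m1 v).1 hv).2
      exact ⟨u, hu, hA.prop.2 u huA, fun h => ((m1 u).1 h).2 (hAM huA)⟩
  · intro v
    rw [List.mem_append, m1, m2]
    tauto
end

section
/- Let G = (V,E) be a finite simple graph and w a word over V. Then w prefixes MIS(G) (i.e. MIS^w(x) is the characteristic vector of an independent set for every configuration x) if and only if [w] is a vertex cover of G. -/
variable {V : Type*}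

theorem misWord_notMem [DecidableEq V] (G : SimpleGraph V) (w : List V) (x : V → Prop) (u : V)
    (hu : u ∉ w) : misWord G w x u = x u := by
  induction w using List.reverseRecOn with
  | nil => rfl
  | append_singleton w a ih =>
    simp only [List.mem_append, List.mem_singleton, not_or] at hu
    have := ih hu.1
    simp only [misWord, List.foldl_append, List.foldl_cons, List.foldl_nil, misStep] at this ⊢
    rw [Function.update_of_ne hu.2, this]

theorem misWord_edge [DecidableEq V] (G : SimpleGraph V) (w : List V) (x : V → Prop) (u v : V)
    (h : G.Adj u v) (hw : u ∈ w ∨ v ∈ w) (hu : misWord G w x u) (hv : misWord G w x v) : False := by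
  induction w using List.reverseRecOn with
  | nil => simp at hw
  | append_singleton w a ih =>
    have e : misWord G (w ++ [a]) x = misStep G (misWord G w x) a := by
      simp [misWord]
    rw [e, misStep] at hu hv
    by_cases hua : u = a
    · subst hua
      rw [Function.update_self] at hu
      rw [Function.update_of_ne h.ne'] at hv
      exact hu v h.symm hv
    · by_cases hva : v = a
      · subst hva
        rw [Function.update_self] at hv
        rw [Function.update_of_ne h.ne] at hu
        exact hv u h hu
      · rw [Function.update_of_ne hua] at hu
        rw [Function.update_of_ne hva] at hv
        simp only [List.mem_append, List.mem_singleton, hua, hva, or_false] at hw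
        exact ih hw hu hv

/-- A word `w` prefixes `MIS(G)` (the support of `MIS^w(x)` is an independent set for
every configuration `x`) iff the set of vertices occurring in `w` is a vertex cover. -/
theorem stmt_5 [DecidableEq V] [Fintype V] (G : SimpleGraph V) (w : List V) :
    (∀ x : V → Prop, IsIndepSet G {v | misWord G w x v}) ↔
    (∀ u v, G.Adj u v → u ∈ w ∨ v ∈ w) := by
  constructor
  · intro H u v h
    by_contra hc
    rw [not_or] at hc
    have hu : misWord G w (fun _ => True) u := by
      rw [misWord_notMem G w _ u hc.1]; trivial
    have hv : misWord G w (fun _ => True) v := by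
      rw [misWord_notMem G w _ v hc.2]; trivial
    exact H (fun _ => True) hu hv h
  · intro H x u hu v hv h
    exact misWord_edge G w x u v h (H u v h) hu hv
end

section
/- Let G = (V,E) be a finite simple graph and S ⊆ V. The following are equivalent: (1) S is a fixing set of MIS(G), i.e. there exists a word w with [w] = S that fixes MIS(G); (2) for all words w^p, w^s with [w^p] = [w^s] = S, the concatenation w^p w^s fixes MIS(G); (3) S is both a vertex cover of G and a non-district of G. -/
variable {V : Type*}

/-- `T` is a district of `G`: there is a vertex `v ∉ T` such that `T ∩ N(v)` is a
constituency of the induced subgraph `G - v`. -/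
def District (G : SimpleGraph V) (T : Set V) : Prop :=
  ∃ v : V, v ∉ T ∧ Constituency (G.induce {u | u ≠ v})
    {u : {u // u ≠ v} | u.1 ∈ T ∧ G.Adj v u.1}

/-- The word `w` fixes `MIS(G)`: from any configuration, `MIS^w` reaches the
characteristic vector of a maximal independent set. -/
def FixesMIS [DecidableEq V] (G : SimpleGraph V) (w : List V) : Prop :=
  ∀ x : V → Prop, IsMaxIndepSet G {v | misWord G w x v}

theorem misStep_self [DecidableEq V] (G : SimpleGraph V) (x : V → Prop) (v : V) :
    misStep G x v v ↔ ∀ u, G.Adj u v → ¬ x u := by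
  simp [misStep]

theorem misStep_ne [DecidableEq V] (G : SimpleGraph V) (x : V → Prop) {v u : V} (h : u ≠ v) :
    misStep G x v u ↔ x u := by
  simp [misStep, h]

/-- An invariant of the allowed steps is an invariant of words. -/
theorem misWord_inv_s8 [DecidableEq V] (G : SimpleGraph V) (P : (V → Prop) → Prop) (w : List V)
    (h : ∀ x, ∀ v ∈ w, P x → P (misStep G x v)) (x : V → Prop) (hx : P x) :
    P (misWord G w x) := by
  induction w generalizing x with
  | nil => exact hx
  | cons a w ih =>
    exact ih (fun x v hv => h x v (List.mem_cons_of_mem _ hv)) _ (h x a List.mem_cons_self hx)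

/-- A property established by updating `v` and preserved by the steps holds after the word. -/
theorem misWord_reach [DecidableEq V] (G : SimpleGraph V) (P Q : (V → Prop) → Prop) (w : List V)
    (v : V) (hv : v ∈ w) (hQ : ∀ x u, Q x → Q (misStep G x u))
    (h : ∀ x u, Q x → P x → P (misStep G x u)) (h0 : ∀ x, Q x → P (misStep G x v))
    (x : V → Prop) (hx : Q x) : P (misWord G w x) := by
  induction w generalizing x with
  | nil => simp at hv
  | cons a w ih =>
    rcases List.mem_cons.1 hv with rfl | hv
    · exact (misWord_inv_s8 G (fun x => Q x ∧ P x) w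
        (fun x u _ hx => ⟨hQ x u hx.1, h x u hx.1 hx.2⟩) _ ⟨hQ x v hx, h0 x hx⟩).2
    · exact ih hv _ (hQ x a hx)

theorem step_edge [DecidableEq V] (G : SimpleGraph V) {a b : V} (hab : G.Adj a b)
    (x : V → Prop) (v : V) (h : v = a ∨ v = b ∨ ¬ (x a ∧ x b)) :
    ¬ (misStep G x v a ∧ misStep G x v b) := by
  rintro ⟨h1, h2⟩
  have hne := hab.ne
  by_cases ha : v = a
  · subst ha
    rw [misStep_self] at h1
    rw [misStep_ne G x hne.symm] at h2
    exact h1 b hab.symm h2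
  by_cases hb : v = b
  · subst hb
    rw [misStep_self] at h2
    rw [misStep_ne G x hne] at h1
    exact h2 a hab h1
  · rw [misStep_ne G x (Ne.symm ha)] at h1
    rw [misStep_ne G x (Ne.symm hb)] at h2
    tauto

theorem step_indep [DecidableEq V] (G : SimpleGraph V) (x : V → Prop) (v : V)
    (h : ∀ a b, G.Adj a b → ¬ (x a ∧ x b)) :
    ∀ a b, G.Adj a b → ¬ (misStep G x v a ∧ misStep G x v b) :=
  fun a b hab => step_edge G hab x v (Or.inr (Or.inr (h a b hab)))

theorem step_mono [DecidableEq V] (G : SimpleGraph V) (x : V → Prop) (v : V)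
    (h : ∀ a b, G.Adj a b → ¬ (x a ∧ x b)) {u : V} (hu : x u) : misStep G x v u := by
  by_cases huv : u = v
  · subst huv
    rw [misStep_self]
    exact fun t ht hxt => h t u ht ⟨hxt, hu⟩
  · rwa [misStep_ne G x huv]

theorem cover_nondistrict_fixes [DecidableEq V] (G : SimpleGraph V) (S : Set V)
    (hc : ∀ u v, G.Adj u v → u ∈ S ∨ v ∈ S) (hd : ¬ District G S) (wp ws : List V)
    (hp : {v | v ∈ wp} = S) (hs : {v | v ∈ ws} = S) : FixesMIS G (wp ++ ws) := by
  intro x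
  have hcat : misWord G (wp ++ ws) x = misWord G ws (misWord G wp x) := by
    simp [misWord]
  rw [hcat]
  have hind : ∀ a b, G.Adj a b → ¬ (misWord G wp x a ∧ misWord G wp x b) := by
    intro a b hab
    have key : ∀ c, c ∈ S → (c = a ∨ c = b) → ¬ (misWord G wp x a ∧ misWord G wp x b) := by
      intro c hcS hcab
      rw [← hp] at hcS
      exact misWord_reach G (fun x => ¬ (x a ∧ x b)) (fun _ => True) wp c hcS
        (fun _ _ _ => trivial)
        (fun x u _ h => step_edge G hab x u (Or.inr (Or.inr h)))
        (fun x _ => step_edge G hab x c (by tauto)) x trivial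
    rcases hc a b hab with h | h
    · exact key a h (Or.inl rfl)
    · exact key b h (Or.inr rfl)
  generalize misWord G wp x = y at hind
  have hindz := misWord_inv_s8 G (fun x => ∀ a b, G.Adj a b → ¬ (x a ∧ x b)) ws
    (fun x v _ h => step_indep G x v h) y hind
  have hdom : ∀ s ∈ S, misWord G ws y s ∨ ∃ t, G.Adj t s ∧ misWord G ws y t := by
    intro s hsS
    rw [← hs] at hsS
    refine misWord_reach G (fun x => x s ∨ ∃ t, G.Adj t s ∧ x t)
      (fun x => ∀ a b, G.Adj a b → ¬ (x a ∧ x b)) ws s hsS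
      (fun x v h => step_indep G x v h) ?_ ?_ y hind
    · rintro x u hx (h | ⟨t, ht, h⟩)
      · exact Or.inl (step_mono G x u hx h)
      · exact Or.inr ⟨t, ht, step_mono G x u hx h⟩
    · intro x hx
      by_cases h : ∀ u, G.Adj u s → ¬ x u
      · exact Or.inl ((misStep_self G x s).2 h)
      · push Not at h
        obtain ⟨t, ht, h⟩ := h
        exact Or.inr ⟨t, ht, (misStep_ne G x ht.ne).2 h⟩
  generalize misWord G ws y = z at hindz hdom
  refine ⟨fun a ha b hb hab => hindz a b hab ⟨ha, hb⟩, fun T hT hzT => ?_⟩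
  refine Set.Subset.antisymm (fun v hvT => ?_) hzT
  by_contra hzv
  have hno : ∀ t, G.Adj t v → ¬ z t := fun t ht hzt => hT (hzT hzt) hvT ht
  have hzv' : ¬ z v := hzv
  by_cases hvS : v ∈ S
  · rcases hdom v hvS with h | ⟨t, ht, h⟩
    · exact hzv h
    · exact hno t ht h
  · refine hd ⟨v, hvS, {u | z u.1}, fun a ha b hb hab => hindz a.1 b.1 hab ⟨ha, hb⟩, ?_⟩
    rintro ⟨u, huv⟩ ⟨huS, hvu⟩
    rcases hdom u huS with h | ⟨t, ht, h⟩
    · exact absurd h (hno u hvu.symm)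
    · exact ⟨⟨t, fun e => hzv' (e ▸ h)⟩, h, ht⟩

theorem fixes_cover [DecidableEq V] (G : SimpleGraph V) (w : List V) (hw : FixesMIS G w) :
    ∀ u v, G.Adj u v → u ∈ w ∨ v ∈ w := by
  intro u v huv
  by_contra hcon
  push Not at hcon
  have h := misWord_inv_s8 G (fun x => x u ∧ x v) w (fun x a ha hx =>
    ⟨(misStep_ne G x (fun e : u = a => hcon.1 (e ▸ ha))).2 hx.1,
     (misStep_ne G x (fun e : v = a => hcon.2 (e ▸ ha))).2 hx.2⟩) (fun _ => True) ⟨trivial, trivial⟩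
  exact (hw _).1 h.1 h.2 huv

theorem fixes_nondistrict [DecidableEq V] (G : SimpleGraph V) (w : List V) (hw : FixesMIS G w) :
    ¬ District G {v | v ∈ w} := by
  rintro ⟨v, hv, I, hI, hdom⟩
  have hc := fixes_cover G w hw
  have hv' : v ∉ w := hv
  have h := misWord_inv_s8 G (fun x => ¬ x v ∧ (∀ i ∈ I, x i.1) ∧
      ∀ i ∈ I, ∀ u, G.Adj i.1 u → ¬ x u) w ?_ (fun u => ∃ h : u ≠ v, (⟨u, h⟩ : {u // u ≠ v}) ∈ I) ?_
  · obtain ⟨h1, h2, h3⟩ := h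
    have hz := hw (fun u => ∃ h : u ≠ v, (⟨u, h⟩ : {u // u ≠ v}) ∈ I)
    generalize misWord G w _ = z at h1 h2 h3 hz
    have hN : ∀ u, G.Adj v u → ¬ z u := by
      intro u hu
      have huw : u ∈ w := (hc v u hu).resolve_left hv'
      obtain ⟨i, hi, hiu⟩ := @hdom ⟨u, hu.ne'⟩ ⟨huw, hu⟩
      exact h3 i hi u hiu
    have := hz.2 (insert v {u | z u}) ?_ (Set.subset_insert _ _)
    · exact h1 (show v ∈ {u | z u} from this ▸ Set.mem_insert _ _)
    · rintro a (rfl | ha) b (rfl | hb) hab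
      · exact hab.ne rfl
      · exact hN b hab hb
      · exact hN a hab.symm ha
      · exact hz.1 ha hb hab
  · rintro x a ha ⟨h1, h2, h3⟩
    refine ⟨?_, ?_, ?_⟩
    · rwa [misStep_ne G x (fun e : v = a => hv' (e ▸ ha))]
    · intro i hi
      by_cases e : i.1 = a
      · subst e
        rw [misStep_self]
        exact fun u hu => h3 i hi u hu.symm
      · exact (misStep_ne G x e).2 (h2 i hi)
    · intro i hi u hu
      by_cases e : u = a
      · subst e
        rw [misStep_self]
        exact fun h => h i.1 hu (h2 i hi)
      · rw [misStep_ne G x e]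
        exact h3 i hi u hu
  · refine ⟨fun h => h.1 rfl, fun i hi => ⟨i.2, hi⟩, ?_⟩
    rintro i hi u hu ⟨huv, huI⟩
    exact hI hi huI hu

/-- Characterisation of fixing sets: `S` supports a fixing word, iff every pair of
words with vertex set `S` concatenates to a fixing word, iff `S` is both a vertex
cover and a non-district of `G`. -/
theorem stmt_8 [DecidableEq V] [Fintype V] (G : SimpleGraph V) (S : Set V) :
    List.TFAE [
      ∃ w : List V, {v | v ∈ w} = S ∧ FixesMIS G w,
      ∀ wp ws : List V, {v | v ∈ wp} = S → {v | v ∈ ws} = S → FixesMIS G (wp ++ ws),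
      (∀ u v, G.Adj u v → u ∈ S ∨ v ∈ S) ∧ ¬ District G S
    ] := by
  tfae_have 1 → 3 := by
    rintro ⟨w, rfl, hw⟩
    exact ⟨fixes_cover G w hw, fixes_nondistrict G w hw⟩
  tfae_have 3 → 2 := fun h wp ws hp hs => cover_nondistrict_fixes G S h.1 h.2 wp ws hp hs
  tfae_have 2 → 1 := by
    intro h
    have hl : {v | v ∈ (Set.toFinite S).toFinset.toList} = S := by
      ext v; simp
    refine ⟨_, ?_, h _ _ hl hl⟩
    ext v; simp
  tfae_finish
end

section
/- Let G be a finite simple graph. The following are equivalent: (1) G admits a near-transitive orientation (an orientation in which every vertex is near-transitive); (2) G admits a near-transitive acyclic orientation; (3) the subgraph of G induced on its benjamins is a comparability graph, i.e. admits a transitive orientation. -/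
variable {V : Type*}

/-- `r` is an orientation of `G`: every arc of `r` is an edge of `G`, and every edge
of `G` gets exactly one of its two possible directions. -/
def IsOrientation {W : Type*} (G : SimpleGraph W) (r : W → W → Prop) : Prop :=
  (∀ u v, r u v → G.Adj u v) ∧ (∀ u v, G.Adj u v → (r u v ↔ ¬ r v u))

/-- The vertex `t` is transitive in the orientation `r`. -/
def TransitiveVertex {W : Type*} (r : W → W → Prop) (t : W) : Prop :=
  ∀ a b, r t a → r a b → r t b

/-- The vertex `v` is near-transitive in the orientation `r` of `G`: some transitive
vertex `t` satisfies `N[t] ⊆ N[v]` (closed neighbourhoods in `G`). -/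
def NearTransitiveVertex {W : Type*} (G : SimpleGraph W) (r : W → W → Prop) (v : W) : Prop :=
  ∃ t, TransitiveVertex r t ∧ insert t (G.neighborSet t) ⊆ insert v (G.neighborSet v)

/-- The vertex `m` is a benjamin of `G`: no closed neighbourhood is strictly contained
in that of `m`. -/
def Benjamin {W : Type*} (G : SimpleGraph W) (m : W) : Prop :=
  ¬ ∃ v, insert v (G.neighborSet v) ⊂ insert m (G.neighborSet m)

/-- Closed neighbourhood. -/
def clN {W : Type*} (G : SimpleGraph W) (v : W) : Set W := insert v (G.neighborSet v)

theorem mem_clN {W : Type*} (G : SimpleGraph W) (v w : W) : w ∈ clN G v ↔ w = v ∨ G.Adj v w :=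
  Iff.rfl

theorem exists_benjamin_below {W : Type*} [Finite W] (G : SimpleGraph W) (v : W) :
    ∃ t, Benjamin G t ∧ clN G t ⊆ clN G v := by
  have hwf : WellFounded (fun a b : W => clN G a ⊂ clN G b) :=
    InvImage.wf (clN G) wellFounded_lt
  induction v using hwf.induction with
  | _ v ih =>
    by_cases h : Benjamin G v
    · exact ⟨v, h, subset_rfl⟩
    · obtain ⟨w, hw⟩ := not_not.mp h
      obtain ⟨t, ht, hs⟩ := ih w hw
      exact ⟨t, ht, hs.trans hw.1⟩

theorem one_imp_three {W : Type*} [Fintype W] (G : SimpleGraph W) (r : W → W → Prop)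
    (ho : IsOrientation G r) (hn : ∀ v, NearTransitiveVertex G r v) :
    ∃ r, IsOrientation (G.induce {m | Benjamin G m}) r ∧ ∀ t, TransitiveVertex r t := by
  classical
  let e := Fintype.equivFin W
  have key : ∀ S : Set W, (∃ m, Benjamin G m ∧ clN G m = S) →
      ∃ t : W, TransitiveVertex r t ∧ clN G t = S := by
    rintro S ⟨m, hm, rfl⟩
    obtain ⟨t, ht, hs⟩ := hn m
    refine ⟨t, ht, ?_⟩
    by_contra hne
    exact hm ⟨t, hs.ssubset_of_ne hne⟩
  choose g hg1 hg2 using key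
  let B := {m | Benjamin G m}
  let f : B → W := fun m => g (clN G m.1) ⟨m.1, m.2, rfl⟩
  have f1 : ∀ m, TransitiveVertex r (f m) := fun m => hg1 _ _
  have f2 : ∀ m, clN G (f m) = clN G m.1 := fun m => hg2 _ _
  have f3 : ∀ m n : B, clN G m.1 = clN G n.1 → f m = f n := by
    intro m n h
    simp only [f, h]
  have irr : ∀ a, ¬ r a a := fun a h => (ho.1 a a h).ne rfl
  have memc : ∀ a b, a ∈ clN G b → b ∈ clN G a := by
    intro a b h
    rcases h with h | h
    · exact Or.inl h.symm
    · exact Or.inr (SimpleGraph.Adj.symm h)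
  have adj : ∀ m n : B, f m ≠ f n → (G.Adj m.1 n.1 ↔ G.Adj (f m) (f n)) := by
    intro m n hne
    have h0 : m.1 ≠ n.1 := fun h => hne (by rw [Subtype.ext h])
    have e1 : G.Adj m.1 n.1 ↔ n.1 ∈ clN G m.1 := by
      rw [mem_clN]; exact ⟨Or.inr, fun h => h.resolve_left h0.symm⟩
    have e2 : G.Adj (f m) (f n) ↔ f n ∈ clN G (f m) := by
      rw [mem_clN]; exact ⟨Or.inr, fun h => h.resolve_left hne.symm⟩
    rw [e1, e2, f2 m]
    constructor
    · intro h
      have := memc _ _ h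
      rw [← f2 n] at this
      exact memc _ _ this
    · intro h
      have := memc _ _ h
      rw [f2 n] at this
      exact memc _ _ this
  have adj' : ∀ m n : B, f m = f n → m ≠ n → G.Adj m.1 n.1 := by
    intro m n h hne
    have h1 : n.1 ∈ clN G m.1 := by
      rw [← f2 m, h, f2 n]; exact Or.inl rfl
    exact h1.resolve_left fun h => hne (Subtype.ext h.symm)
  refine ⟨fun u v => r (f u) (f v) ∨ (f u = f v ∧ e u.1 < e v.1), ⟨?_, ?_⟩, ?_⟩
  · rintro u v (h | ⟨h, h'⟩)
    · exact (adj u v fun h' => irr _ (h' ▸ h)).2 (ho.1 _ _ h)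
    · exact adj' u v h fun h => lt_irrefl _ (h ▸ h')
  · intro u v huv
    have huv' : G.Adj u.1 v.1 := huv
    by_cases h : f u = f v
    · have h1 : e u.1 ≠ e v.1 := fun h => huv'.ne (e.injective h)
      have := irr (f v)
      simp only [h, this, true_and, false_or, not_lt]
      exact ⟨le_of_lt, fun h => lt_of_le_of_ne h h1⟩
    · have := ho.2 _ _ ((adj u v h).1 huv')
      simp only [h, Ne.symm h, false_and, or_false, this]
  · rintro u v w (h | ⟨h, h'⟩) (k | ⟨k, k'⟩)
    · exact Or.inl (f1 _ _ _ h k)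
    · exact Or.inl (k ▸ h)
    · exact Or.inl (h ▸ k)
    · exact Or.inr ⟨h.trans k, h'.trans k'⟩

theorem three_imp_two {W : Type*} [Fintype W] (G : SimpleGraph W)
    (s : {m | Benjamin G m} → {m | Benjamin G m} → Prop)
    (ho : IsOrientation (G.induce {m | Benjamin G m}) s) (ht : ∀ t, TransitiveVertex s t) :
    ∃ r : W → W → Prop, IsOrientation G r ∧ (∀ v, ¬ Relation.TransGen r v v) ∧
        ∀ v, NearTransitiveVertex G r v := by
  classical
  let e := Fintype.equivFin W
  have hirr : ∀ a, ¬ s a a := fun a h => (ho.1 a a h).ne rfl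
  let R : W → W → Prop := fun u v => (¬ Benjamin G u ∧ Benjamin G v) ∨
    (¬ Benjamin G u ∧ ¬ Benjamin G v ∧ e u < e v) ∨
    (∃ hu : Benjamin G u, ∃ hv : Benjamin G v, s ⟨u, hu⟩ ⟨v, hv⟩)
  have Rtrans : ∀ a b c, R a b → R b c → R a c := by
    rintro a b c (⟨h1, h2⟩ | ⟨h1, h2, h3⟩ | ⟨h1, h2, h3⟩) (⟨k1, k2⟩ | ⟨k1, k2, k3⟩ | ⟨k1, k2, k3⟩)
    all_goals first
      | contradiction
      | exact Or.inl ⟨h1, k2⟩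
      | exact Or.inr (Or.inl ⟨h1, k2, h3.trans k3⟩)
      | exact Or.inr (Or.inr ⟨h1, k2, ht _ _ _ h3 k3⟩)
  have Rirr : ∀ a, ¬ R a a := by
    rintro a (⟨h1, h2⟩ | ⟨h1, h2, h3⟩ | ⟨h1, h2, h3⟩)
    · exact h1 h2
    · exact lt_irrefl _ h3
    · exact hirr _ h3
  have Rtot : ∀ a b, G.Adj a b → R a b ∨ R b a := by
    intro a b hab
    by_cases ha : Benjamin G a <;> by_cases hb : Benjamin G b
    · by_cases h : s ⟨b, hb⟩ ⟨a, ha⟩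
      · exact Or.inr (Or.inr (Or.inr ⟨hb, ha, h⟩))
      · exact Or.inl (Or.inr (Or.inr ⟨ha, hb, (ho.2 ⟨a, ha⟩ ⟨b, hb⟩ hab).2 h⟩))
    · exact Or.inr (Or.inl ⟨hb, ha⟩)
    · exact Or.inl (Or.inl ⟨ha, hb⟩)
    · rcases lt_trichotomy (e a) (e b) with h | h | h
      · exact Or.inl (Or.inr (Or.inl ⟨ha, hb, h⟩))
      · exact (hab.ne (e.injective h)).elim
      · exact Or.inr (Or.inr (Or.inl ⟨hb, ha, h⟩))
  refine ⟨fun u v => G.Adj u v ∧ R u v, ⟨fun u v h => h.1, fun u v huv => ⟨?_, ?_⟩⟩, ?_, ?_⟩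
  · rintro ⟨-, h⟩ ⟨-, h'⟩
    exact Rirr _ (Rtrans _ _ _ h h')
  · intro h
    exact ⟨huv, (Rtot u v huv).resolve_right fun h' => h ⟨huv.symm, h'⟩⟩
  · intro v hv
    have : ∀ a b, Relation.TransGen (fun u v => G.Adj u v ∧ R u v) a b → R a b := by
      intro a b h
      induction h with
      | single h => exact h.2
      | tail _ h ih => exact Rtrans _ _ _ ih h.2
    exact Rirr v (this v v hv)
  · intro v
    obtain ⟨t, hB, hs⟩ := exists_benjamin_below G v
    refine ⟨t, ?_, hs⟩
    rintro a b ⟨-, hta⟩ ⟨-, hab⟩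
    refine ⟨?_, Rtrans _ _ _ hta hab⟩
    rcases hta with ⟨h1, h2⟩ | ⟨h1, h2, h3⟩ | ⟨h1, h2, h3⟩
    · exact (h1 hB).elim
    · exact (h1 hB).elim
    rcases hab with ⟨k1, k2⟩ | ⟨k1, k2, k3⟩ | ⟨k1, k2, k3⟩
    · exact (k1 h2).elim
    · exact (k1 h2).elim
    · exact ho.1 _ _ (ht _ _ _ h3 k3)

/-- A graph is a near-comparability graph (admits an orientation where every vertex is
near-transitive), iff it admits a near-transitive *acyclic* orientation, iff the
subgraph induced on its benjamins admits a transitive orientation (is a comparability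
graph). -/
theorem stmt_10 [Fintype V] (G : SimpleGraph V) :
    List.TFAE [
      ∃ r : V → V → Prop, IsOrientation G r ∧ ∀ v, NearTransitiveVertex G r v,
      ∃ r : V → V → Prop, IsOrientation G r ∧ (∀ v, ¬ Relation.TransGen r v v) ∧
        ∀ v, NearTransitiveVertex G r v,
      ∃ r, IsOrientation (G.induce {m | Benjamin G m}) r ∧ ∀ t, TransitiveVertex r t
    ] := by
  tfae_have 2 → 1 := fun ⟨r, h1, _, h3⟩ => ⟨r, h1, h3⟩
  tfae_have 1 → 3 := fun ⟨r, h1, h2⟩ => one_imp_three G r h1 h2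
  tfae_have 3 → 2 := fun ⟨s, h1, h2⟩ => three_imp_two G s h1 h2
  tfae_finish
end

section
/- For every integer k ≥ 3, the cycle graph C_{2k+1} on 2k+1 vertices is not permissible: no permutation w of its vertex set satisfies that MIS^w(x) is the characteristic vector of a maximal independent set of C_{2k+1} for every configuration x. -/
variable {V : Type*}

/-- `G` is permissible: it has a permis, i.e. a permutation `w` of the vertex set such
that `MIS^w(x)` is the characteristic vector of a maximal independent set for all `x`. -/
def Permissible {W : Type*} [DecidableEq W] (G : SimpleGraph W) : Prop :=
  ∃ w : List W, w.Nodup ∧ (∀ v : W, v ∈ w) ∧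
    ∀ x : W → Prop, IsMaxIndepSet G {v | misWord G w x v}

theorem misWord_not_mem [DecidableEq V] (G : SimpleGraph V) (w : List V) (x : V → Prop) (v : V)
    (h : v ∉ w) : misWord G w x v = x v := by
  induction w generalizing x with
  | nil => rfl
  | cons a l ih =>
    simp only [List.mem_cons, not_or] at h
    have : misWord G (a :: l) x = misWord G l (misStep G x a) := rfl
    rw [this, ih _ h.2]
    simp [misStep, Function.update_of_ne h.1]

theorem misWord_append [DecidableEq V] (G : SimpleGraph V) (w w' : List V) (x : V → Prop) :
    misWord G (w ++ w') x = misWord G w' (misWord G w x) := by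
  simp [misWord, List.foldl_append]

theorem misWord_char [DecidableEq V] (G : SimpleGraph V) (w : List V) (x : V → Prop) (v : V)
    (hn : w.Nodup) (hw : ∀ v, v ∈ w) :
    misWord G w x v ↔ ∀ u, G.Adj u v →
      ((w.idxOf u < w.idxOf v → ¬ misWord G w x u) ∧ (w.idxOf v < w.idxOf u → ¬ x u)) := by
  obtain ⟨l, r, rfl⟩ := List.append_of_mem (hw v)
  rw [List.nodup_append] at hn
  obtain ⟨h1, h2, h3⟩ := hn
  have hvl : v ∉ l := fun h => h3 v h v (by simp) rfl
  have hvr : v ∉ r := (List.nodup_cons.1 h2).1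
  have hv : misWord G (l ++ v :: r) x v = ∀ u, G.Adj u v → ¬ misWord G l x u := by
    rw [misWord_append]
    have : misWord G (v :: r) (misWord G l x) = misWord G r (misStep G (misWord G l x) v) := rfl
    rw [this, misWord_not_mem _ _ _ _ hvr]
    simp [misStep]
  have iv : (l ++ v :: r).idxOf v = l.length := by
    rw [List.idxOf_append_of_notMem hvl]; simp
  rw [hv, iv]
  refine forall_congr' fun u => forall_congr' fun hu => ?_
  by_cases hul : u ∈ l
  · have e1 : (l ++ v :: r).idxOf u < l.length := by
      rw [List.idxOf_append_of_mem hul]; exact List.idxOf_lt_length_of_mem hul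
    have e2 : misWord G (l ++ v :: r) x u = misWord G l x u := by
      rw [misWord_append, misWord_not_mem]
      exact fun h => h3 u hul u h rfl
    rw [e2]
    constructor
    · intro h; exact ⟨fun _ => h, fun h' => by omega⟩
    · intro h; exact h.1 e1
  · have e1 : l.length < (l ++ v :: r).idxOf u := by
      rw [List.idxOf_append_of_notMem hul, List.idxOf_cons_ne _ (G.ne_of_adj hu).symm]; omega
    rw [misWord_not_mem G l x u hul]
    constructor
    · intro h; exact ⟨fun h' => by omega, fun _ => h⟩
    · intro h; exact h.2 e1

theorem not_permis_of_path [DecidableEq V] (G : SimpleGraph V) (w : List V)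
    (hn : w.Nodup) (hw : ∀ v, v ∈ w)
    (H : ∀ x : V → Prop, IsMaxIndepSet G {v | misWord G w x v})
    (t u v s r q : V)
    (hut : G.Adj t u) (hv : ∀ z, G.Adj z v ↔ z = u ∨ z = s)
    (hs : ∀ z, G.Adj z s ↔ z = v ∨ z = r)
    (hr : ∀ z, G.Adj z r ↔ z = s ∨ z = q)
    (s1 : s ≠ v) (s2 : s ≠ u) (s3 : s ≠ t) (s4 : s ≠ r)
    (q1 : q ≠ v) (q2 : q ≠ u) (q3 : q ≠ t) (q4 : q ≠ r)
    (p1 : w.idxOf v < w.idxOf u) (p2 : w.idxOf u < w.idxOf t) : False := by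
  set x : V → Prop := fun z => z = v ∨ z = u ∨ z = t ∨ z = r with hx
  have C := fun z => misWord_char G w x z hn hw
  obtain ⟨hi, hm⟩ := H x
  set y := misWord G w x with hy
  have tot : ∀ a b : V, a ≠ b → w.idxOf a < w.idxOf b ∨ w.idxOf b < w.idxOf a := by
    intro a b hab
    rcases lt_trichotomy (w.idxOf a) (w.idxOf b) with h | h | h
    · exact Or.inl h
    · exact absurd ((List.idxOf_inj (hw a)).1 h) hab
    · exact Or.inr h
  have xv : x v := by simp [hx]
  have xu : x u := by simp [hx]
  have xt : x t := by simp [hx]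
  have xr : x r := by simp [hx]
  have xs : ¬ x s := by simp [hx, *]
  have xq : ¬ x q := by simp [hx, *]
  have yu : ¬ y u := fun h => ((C u).1 h t hut).2 p2 xt
  have yv : ¬ y v := fun h => ((C v).1 h u ((hv u).2 (Or.inl rfl))).2 p1 xu
  have ys : ¬ y s := by
    intro h
    have c1 := (C s).1 h v ((hs v).2 (Or.inl rfl))
    have c2 := (C s).1 h r ((hs r).2 (Or.inr rfl))
    rcases tot s r s4 with h1 | h1
    · exact c2.2 h1 xr
    · apply c2.1 h1
      rw [C r]
      intro z hz
      rcases (hr z).1 hz with rfl | rfl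
      · exact ⟨fun h' => by omega, fun _ => xs⟩
      · refine ⟨fun h' h2 => ?_, fun _ => xq⟩
        exact ((C _).1 h2 r hz.symm).2 h' xr
  have key := hm (insert v {z | y z}) (by
    have nb : ∀ b, y b → ¬ G.Adj b v := by
      intro b hb hab
      rcases (hv b).1 hab with rfl | rfl
      · exact yu hb
      · exact ys hb
    intro a ha b hb hab
    rcases ha with rfl | ha <;> rcases hb with rfl | hb
    · exact G.irrefl hab
    · exact nb b hb hab.symm
    · exact nb a ha hab
    · exact hi ha hb hab) (Set.subset_insert _ _)
  exact yv (key ▸ Set.mem_insert v {z | y z} : v ∈ {z | y z})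

open Fin.CommRing in
theorem no_path (k : ℕ) (hk : 3 ≤ k) (w : List (Fin (2 * k + 1)))
    (hn : w.Nodup) (hw : ∀ v, v ∈ w)
    (H : ∀ x : Fin (2 * k + 1) → Prop,
      IsMaxIndepSet (SimpleGraph.cycleGraph (2 * k + 1))
        {v | misWord (SimpleGraph.cycleGraph (2 * k + 1)) w x v})
    (v e : Fin (2 * k + 1)) (he : e = 1 ∨ e = -1)
    (p1 : w.idxOf v < w.idxOf (v + e)) (p2 : w.idxOf (v + e) < w.idxOf (v + 2 * e)) : False := by
  obtain ⟨m, rfl⟩ : ∃ m, k = m + 3 := ⟨k - 3, by omega⟩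
  have adj : ∀ a b : Fin (2 * (m + 3) + 1), (SimpleGraph.cycleGraph (2 * (m + 3) + 1)).Adj a b ↔
      a = b + e ∨ a = b - e := by
    intro a b
    have h0 : (SimpleGraph.cycleGraph (2 * (m + 3) + 1)).Adj a b ↔ a - b = 1 ∨ b - a = 1 :=
      SimpleGraph.cycleGraph_adj (n := 2 * m + 5)
    rw [h0]
    have h1 : a - b = 1 ↔ a = b + 1 := by
      constructor <;> intro h <;> linear_combination h
    have h2 : b - a = 1 ↔ a = b - 1 := by
      constructor <;> intro h <;> linear_combination -h
    rw [h1, h2]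
    rcases he with rfl | rfl
    · rfl
    · rw [or_comm]; simp [sub_eq_add_neg]
  have nz : ∀ c : ℕ, 0 < c → c < 7 → (c : Fin (2 * (m + 3) + 1)) * e ≠ 0 := by
    intro c c0 c7 h
    have h' : (c : Fin (2 * (m + 3) + 1)) = 0 := by
      rcases he with rfl | rfl
      · simpa using h
      · simpa using h
    rw [Fin.natCast_eq_zero] at h'
    have := Nat.le_of_dvd c0 h'
    omega
  have n1 := nz 1 (by norm_num) (by norm_num)
  have n2 := nz 2 (by norm_num) (by norm_num)
  have n3 := nz 3 (by norm_num) (by norm_num)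
  have n4 := nz 4 (by norm_num) (by norm_num)
  have n5 := nz 5 (by norm_num) (by norm_num)
  push_cast at n1 n2 n3 n4 n5
  refine not_permis_of_path _ w hn hw H (v + 2 * e) (v + e) v (v - e) (v - 2 * e) (v - 3 * e)
    ?_ ?_ ?_ ?_ ?_ ?_ ?_ ?_ ?_ ?_ ?_ ?_ p1 p2
  · rw [adj]; left; ring
  · intro z; rw [adj]
  · intro z; rw [adj]; ring_nf
  · intro z; rw [adj]; ring_nf
  · intro h; apply n1; linear_combination -h
  · intro h; apply n2; linear_combination -h
  · intro h; apply n3; linear_combination -h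
  · intro h; apply n1; linear_combination h
  · intro h; apply n3; linear_combination -h
  · intro h; apply n4; linear_combination -h
  · intro h; apply n5; linear_combination -h
  · intro h; apply n1; linear_combination -h

/-- For every `k ≥ 3`, the odd cycle `C_{2k+1}` is not permissible: no permutation of
its vertex set fixes its MIS network. -/
theorem stmt_14 (k : ℕ) (hk : 3 ≤ k) :
    ¬ Permissible (SimpleGraph.cycleGraph (2 * k + 1)) := by
  open Fin.CommRing in
  rintro ⟨w, hn, hw, H⟩
  have P := no_path k hk w hn hw H
  have tot : ∀ a b : Fin (2 * k + 1), a ≠ b → w.idxOf a < w.idxOf b ∨ w.idxOf b < w.idxOf a := by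
    intro a b hab
    rcases lt_trichotomy (w.idxOf a) (w.idxOf b) with h | h | h
    · exact Or.inl h
    · exact absurd ((List.idxOf_inj (hw a)).1 h) hab
    · exact Or.inr h
  have one : (1 : Fin (2 * k + 1)) ≠ 0 := by
    intro h
    have h' : ((1 : ℕ) : Fin (2 * k + 1)) = 0 := by simpa using h
    rw [Fin.natCast_eq_zero] at h'
    have := Nat.le_of_dvd one_pos h'
    omega
  have alt : ∀ a : Fin (2 * k + 1), w.idxOf (a + 1) < w.idxOf (a + 1 + 1) ↔
      ¬ w.idxOf a < w.idxOf (a + 1) := by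
    intro a
    constructor
    · intro h1 h2
      refine P a 1 (Or.inl rfl) h2 ?_
      have : a + 2 * 1 = a + 1 + 1 := by ring
      rwa [this]
    · intro h
      by_contra h'
      have g1 := (tot a (a + 1) (by simpa using one.symm)).resolve_left h
      have g2 := (tot (a + 1) (a + 1 + 1) (by simpa using one.symm)).resolve_left h'
      refine P (a + 1 + 1) (-1) (Or.inr rfl) ?_ ?_
      · have : a + 1 + 1 + -1 = a + 1 := by ring
        rwa [this]
      · have e1 : a + 1 + 1 + -1 = a + 1 := by ring
        have e2 : a + 1 + 1 + 2 * -1 = a := by ring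
        rwa [e1, e2]
  have alt2 : ∀ j : ℕ, (w.idxOf (((2 * j : ℕ) : Fin (2 * k + 1))) <
      w.idxOf (((2 * j : ℕ) : Fin (2 * k + 1)) + 1)) ↔
      w.idxOf (0 : Fin (2 * k + 1)) < w.idxOf (0 + 1 : Fin (2 * k + 1)) := by
    intro j
    induction j with
    | zero => simp
    | succ j ih =>
      have e : ((2 * (j + 1) : ℕ) : Fin (2 * k + 1)) = ((2 * j : ℕ) : Fin (2 * k + 1)) + 1 + 1 := by
        push_cast; ring
      rw [e, alt, alt, not_not, ih]
  have z : ((2 * k : ℕ) : Fin (2 * k + 1)) + 1 = 0 := by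
    have : ((2 * k + 1 : ℕ) : Fin (2 * k + 1)) = 0 := by
      rw [Fin.natCast_eq_zero]
    rw [← this]; push_cast; rfl
  have a1 := alt ((2 * k : ℕ) : Fin (2 * k + 1))
  rw [alt2 k, z] at a1
  tauto
end

section
/- Let G = (V,E) be a finite simple graph. If G has a tethered set of vertices S (i.e. every s ∈ S is adjacent to every t ∈ N(S) \ S) such that the induced subgraph G[S] has no permis, then G has no permis. -/
variable {V : Type*}

theorem maxIndep_iff {W : Type*} (G : SimpleGraph W) (S : Set W) :
    IsMaxIndepSet G S ↔ IsIndepSet G S ∧ ∀ v, v ∉ S → ∃ u ∈ S, G.Adj u v := by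
  constructor
  · rintro ⟨h1, h2⟩
    refine ⟨h1, fun v hv => ?_⟩
    by_contra hcon
    push Not at hcon
    have h3 := h2 (insert v S) (by
      intro a ha b hb hab
      rcases ha with rfl | ha <;> rcases hb with rfl | hb
      · exact G.loopless.irrefl _ hab
      · exact hcon b hb hab.symm
      · exact hcon a ha hab
      · exact h1 ha hb hab) (Set.subset_insert v S)
    exact hv (h3 ▸ Set.mem_insert v S)
  · rintro ⟨h1, h2⟩
    refine ⟨h1, fun T hT hST => Set.Subset.antisymm (fun v hv => ?_) hST⟩
    by_contra hvS
    obtain ⟨u, hu, huv⟩ := h2 v hvS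
    exact hT (hST hu) hv huv

open Classical in
/-- The restriction of a word to the letters in `S`. -/
noncomputable def restr (S : Set V) (w : List V) : List S :=
  w.filterMap (fun v => if h : v ∈ S then some ⟨v, h⟩ else none)

theorem restr_inv [DecidableEq V] (G : SimpleGraph V) (S : Set V)
    (ht : ∀ t, t ∉ S → ∀ s ∈ S, G.Adj s t → ∀ s' ∈ S, G.Adj s' t) (w : List V) :
    ∀ (x : V → Prop) (y : S → Prop), (∀ s : S, x s ↔ y s) →
      (∀ t, t ∉ S → ∀ s ∈ S, G.Adj s t → ¬ x t) → (∃ s, y s) →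
      (∀ s : S, misWord G w x s ↔ misWord (G.induce S) (restr S w) y s) ∧
      (∀ t, t ∉ S → ∀ s ∈ S, G.Adj s t → ¬ misWord G w x t) := by
  induction w with
  | nil => intro x y h1 h2 _; exact ⟨h1, h2⟩
  | cons v w ih =>
    intro x y h1 h2 ⟨s0, hs0⟩
    by_cases hv : v ∈ S
    · have e : restr S (v :: w) = ⟨v, hv⟩ :: restr S w := by simp [restr, hv]
      rw [e]
      refine ih (misStep G x v) (misStep (G.induce S) y ⟨v, hv⟩) ?_ ?_ ?_
      · intro s
        by_cases hs : s = ⟨v, hv⟩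
        · subst hs
          simp only [misStep, Function.update_self]
          constructor
          · intro h u hu hy
            exact h u hu ((h1 u).2 hy)
          · intro h u hu hx
            by_cases huS : u ∈ S
            · exact h ⟨u, huS⟩ hu ((h1 ⟨u, huS⟩).1 hx)
            · exact h2 u huS v hv hu.symm hx
        · have hs' : (s : V) ≠ v := fun h => hs (Subtype.ext h)
          simp only [misStep, Function.update_of_ne hs, Function.update_of_ne hs']
          exact h1 s
      · intro t htS s hs hst
        have : t ≠ v := fun h => htS (h ▸ hv)
        simp only [misStep, Function.update_of_ne this]
        exact h2 t htS s hs hst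
      · by_cases hall : ∀ u, (G.induce S).Adj u ⟨v, hv⟩ → ¬ y u
        · exact ⟨⟨v, hv⟩, by simpa only [misStep, Function.update_self] using hall⟩
        · push Not at hall
          obtain ⟨u, hu, hyu⟩ := hall
          exact ⟨u, by simpa only [misStep, Function.update_of_ne hu.ne] using hyu⟩
    · have e : restr S (v :: w) = restr S w := by simp [restr, hv]
      rw [e]
      refine ih (misStep G x v) y ?_ ?_ ⟨s0, hs0⟩
      · intro s
        have : (s : V) ≠ v := fun h => hv (h ▸ s.2)
        simp only [misStep, Function.update_of_ne this]
        exact h1 s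
      · intro t htS s hs hst
        by_cases htv : t = v
        · subst htv
          simp only [misStep, Function.update_self]
          intro h
          exact h s0 (ht t htS s hs hst s0 s0.2) ((h1 s0).2 hs0)
        · simp only [misStep, Function.update_of_ne htv]
          exact h2 t htS s hs hst

/-- If `G` has a tethered set `S` (every `s ∈ S` is adjacent to every
`t ∈ N(S) \ S`) such that the induced subgraph `G[S]` has no permis, then `G` has
no permis. -/
theorem stmt_15 [DecidableEq V] [Fintype V] (G : SimpleGraph V) (S : Set V)
    (htether : ∀ s ∈ S, ∀ t ∈ (⋃ s ∈ S, G.neighborSet s) \ S, G.Adj s t)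
    (hS : ¬ Permissible (G.induce S)) :
    ¬ Permissible G := by
  rintro ⟨w, hnd, hmem, hw⟩
  apply hS
  have hm : ∀ s : S, s ∈ restr S w := by
    intro s
    simp only [restr, List.mem_filterMap]
    exact ⟨s, hmem s, by simp⟩
  refine ⟨restr S w, ?_, hm, ?_⟩
  · refine hnd.filterMap ?_
    intro a a' b hb hb'
    simp only [Option.mem_def] at hb hb'
    split_ifs at hb hb' <;> simp_all
    exact (congrArg Subtype.val hb).trans (congrArg Subtype.val hb').symm
  have key : ∀ y : S → Prop, (∃ s, y s) →
      IsMaxIndepSet (G.induce S) {v | misWord (G.induce S) (restr S w) y v} := by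
    intro y hy
    obtain ⟨h1, h2⟩ := restr_inv G S (fun t htS s hs hst s' hs' =>
      htether s' hs' t ⟨Set.mem_biUnion hs hst, htS⟩) w
      (fun v => ∃ h : v ∈ S, y ⟨v, h⟩) y (fun s => by simp)
      (fun t htS _ _ _ h => htS h.1) hy
    obtain ⟨h3, h4⟩ := (maxIndep_iff _ _).1 (hw (fun v => ∃ h : v ∈ S, y ⟨v, h⟩))
    refine (maxIndep_iff _ _).2 ⟨?_, ?_⟩
    · intro a ha b hb hab
      exact h3 ((h1 a).2 ha) ((h1 b).2 hb) hab
    · intro v hv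
      obtain ⟨u, hu, huv⟩ := h4 v (fun h => hv ((h1 v).1 h))
      by_cases huS : u ∈ S
      · exact ⟨⟨u, huS⟩, (h1 ⟨u, huS⟩).1 hu, huv⟩
      · exact absurd hu (h2 u huS v v.2 huv.symm)
  intro y
  rcases hr : restr S w with _ | ⟨s, l⟩
  · refine (maxIndep_iff _ _).2 ⟨fun a => ?_, fun a => ?_⟩ <;>
    · have := hm a
      simp [hr] at this
  · have := key (Function.update y s True) ⟨s, by simp⟩
    rw [hr] at this
    have e : misStep (G.induce S) (Function.update y s True) s = misStep (G.induce S) y s := by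
      unfold misStep
      rw [Function.update_idem]
      congr 1
      apply propext
      refine forall_congr' fun u => forall_congr' fun hu => ?_
      rw [Function.update_of_ne hu.ne]
    simp only [misWord, List.foldl_cons] at this ⊢
    rwa [e] at this
end

section
/- Let G = (V,E) be a finite simple graph. If there exists A ⊆ V such that the induced subgraph G[A] is not permissible and S = N(A) \ A is a constituency of G − A (the subgraph induced on V \ A), then G is not permissible. -/
variable {V : Type*}

/-- Running `w` from `y` acts on `A` as the subword of `w` on `A` acts from `x`, as long as `J` is
frozen at one and its neighbourhood is frozen at zero. -/
theorem misWord_restrict [DecidableEq V] (G : SimpleGraph V) (A J : Set V)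
    (f : V → Option A) (hf1 : ∀ v (h : v ∈ A), f v = some ⟨v, h⟩) (hf0 : ∀ v, v ∉ A → f v = none)
    (hJA : ∀ j ∈ J, j ∉ A) (hind : ∀ i ∈ J, ∀ j ∈ J, ¬ G.Adj i j)
    (hna : ∀ j ∈ J, ∀ a ∈ A, ¬ G.Adj j a)
    (hS : ∀ v, v ∉ A → ∀ a ∈ A, G.Adj a v → ∃ j ∈ J, G.Adj j v) (w : List V) :
    ∀ (y : V → Prop) (x : A → Prop), (∀ j ∈ J, y j) → (∀ j ∈ J, ∀ v, G.Adj j v → ¬ y v) →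
      (∀ a : A, y a ↔ x a) →
      (∀ j ∈ J, ∀ v, G.Adj j v → ¬ misWord G w y v) ∧
      (∀ a : A, misWord G w y a ↔ misWord (G.induce A) (w.filterMap f) x a) := by
  induction w with
  | nil => intro y x h1 h2 h3; exact ⟨h2, h3⟩
  | cons v w ih =>
    intro y x h1 h2 h3
    have g1 : ∀ j ∈ J, misStep G y v j := by
      intro j hj
      by_cases hjv : j = v
      · subst hjv
        simp only [misStep, Function.update_self]
        intro u hu
        exact h2 j hj u hu.symm
      · simp only [misStep, Function.update_of_ne hjv]
        exact h1 j hj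
    have g2 : ∀ j ∈ J, ∀ u, G.Adj j u → ¬ misStep G y v u := by
      intro j hj u hu
      by_cases huv : u = v
      · subst huv
        simp only [misStep, Function.update_self]
        intro h
        exact h j hu (h1 j hj)
      · simp only [misStep, Function.update_of_ne huv]
        exact h2 j hj u hu
    by_cases hv : v ∈ A
    · have e : (v :: w).filterMap f = ⟨v, hv⟩ :: w.filterMap f := by
        simp [List.filterMap_cons, hf1 v hv]
      rw [e]
      refine ih (misStep G y v) (misStep (G.induce A) x ⟨v, hv⟩) g1 g2 ?_
      intro a
      by_cases hav : a = ⟨v, hv⟩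
      · subst hav
        simp only [misStep, Function.update_self]
        constructor
        · intro h u hu hx
          exact h u hu ((h3 u).2 hx)
        · intro h u hu hy
          by_cases hu' : u ∈ A
          · exact h ⟨u, hu'⟩ hu ((h3 ⟨u, hu'⟩).1 hy)
          · obtain ⟨j, hj, hju⟩ := hS u hu' v hv hu.symm
            exact h2 j hj u hju hy
      · have hav' : (a : V) ≠ v := fun h => hav (Subtype.ext h)
        simp only [misStep, Function.update_of_ne hav, Function.update_of_ne hav']
        exact h3 a
    · have e : (v :: w).filterMap f = w.filterMap f := by
        simp [List.filterMap_cons, hf0 v hv]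
      rw [e]
      refine ih (misStep G y v) x g1 g2 ?_
      intro a
      have hav' : (a : V) ≠ v := fun h => hv (h ▸ a.2)
      simp only [misStep, Function.update_of_ne hav']
      exact h3 a

/-- If there is a set `A` of vertices such that the induced subgraph `G[A]` is not
permissible and `N(A) \ A` is a constituency of `G - A`, then `G` is not
permissible. -/
theorem stmt_16 [DecidableEq V] [Fintype V] (G : SimpleGraph V) (A : Set V)
    (hA : ¬ Permissible (G.induce A))
    (hS : Constituency (G.induce Aᶜ)
      {v : ↥Aᶜ | v.1 ∈ (⋃ a ∈ A, G.neighborSet a) \ A}) :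
    ¬ Permissible G := by
  classical
  rintro ⟨w, hnd, hall, hw⟩
  apply hA
  obtain ⟨I, hI, hdom⟩ := hS
  let f : V → Option A := fun v => if h : v ∈ A then some ⟨v, h⟩ else none
  have hf1 : ∀ v (h : v ∈ A), f v = some ⟨v, h⟩ := fun v h => by simp [f, h]
  have hf0 : ∀ v, v ∉ A → f v = none := fun v h => by simp [f, h]
  let J : Set V := Subtype.val '' I
  have hJA : ∀ j ∈ J, j ∉ A := by
    rintro _ ⟨i, hi, rfl⟩
    exact i.2
  have hind : ∀ i ∈ J, ∀ j ∈ J, ¬ G.Adj i j := by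
    rintro _ ⟨i, hi, rfl⟩ _ ⟨j, hj, rfl⟩ h
    exact hI hi hj h
  have hS' : ∀ v, v ∉ A → ∀ a ∈ A, G.Adj a v → ∃ j ∈ J, G.Adj j v := by
    intro v hv a ha hav
    have hm : (⟨v, hv⟩ : ↥Aᶜ) ∈
        {v : ↥Aᶜ | v.1 ∈ (⋃ a ∈ A, G.neighborSet a) \ A} :=
      ⟨Set.mem_biUnion ha hav, hv⟩
    obtain ⟨i, hi, hiv⟩ := hdom hm
    exact ⟨i, ⟨i, hi, rfl⟩, hiv⟩
  have hna : ∀ j ∈ J, ∀ a ∈ A, ¬ G.Adj j a := by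
    intro j hj a ha h
    obtain ⟨i, hi, hij⟩ := hS' j (hJA j hj) a ha h.symm
    exact hind i hi j hj hij
  refine ⟨w.filterMap f, ?_, ?_, ?_⟩
  · refine List.Nodup.filterMap ?_ hnd
    intro a a' b hb hb'
    by_cases h : a ∈ A
    · by_cases h' : a' ∈ A
      · simp [hf1 _ h] at hb
        simp [hf1 _ h'] at hb'
        rw [← hb'] at hb
        exact congrArg Subtype.val hb
      · simp [hf0 _ h'] at hb'
    · simp [hf0 _ h] at hb
  · intro v
    exact List.mem_filterMap.2 ⟨v, hall v, hf1 v v.2⟩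
  · intro x
    let y : V → Prop := fun v => v ∈ J ∨ ∃ h : v ∈ A, x ⟨v, h⟩
    have key := misWord_restrict G A J f hf1 hf0 hJA hind hna hS' w y x
      (fun j hj => Or.inl hj)
      (by
        rintro j hj v hjv (h | ⟨h, -⟩)
        · exact hind j hj v h hjv
        · exact hna j hj v h hjv)
      (by
        intro a
        constructor
        · rintro (h | ⟨_, h⟩)
          · exact absurd a.2 (hJA _ h)
          · exact h
        · intro h
          exact Or.inr ⟨a.2, h⟩)
    obtain ⟨k0, k1⟩ := key
    obtain ⟨m1, m2⟩ := hw y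
    refine ⟨?_, ?_⟩
    · intro u hu v hv h
      exact m1 ((k1 u).2 hu) ((k1 v).2 hv) h
    · intro T hT hsub
      refine Set.Subset.antisymm ?_ hsub
      intro t ht
      have nt : ∀ u, misWord G w y u → ¬ G.Adj t u := by
        intro u hu htu
        by_cases huA : u ∈ A
        · exact hT ht (hsub ((k1 ⟨u, huA⟩).1 hu)) htu
        · obtain ⟨j, hj, hju⟩ := hS' u huA t t.2 htu
          exact k0 j hj u hju hu
      have hins := m2 (insert (t : V) {v | misWord G w y v}) (by
        rintro u (rfl | hu) v (rfl | hv) h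
        · exact G.loopless.irrefl _ h
        · exact nt v hv h
        · exact nt u hu h.symm
        · exact m1 hu hv h) (Set.subset_insert _ _)
      have : (t : V) ∈ {v | misWord G w y v} := by
        rw [← hins]
        exact Set.mem_insert _ _
      exact (k1 t).1 this
end

section
/- Let G be a finite irreflexive digraph. If G has a tethered set of vertices S (i.e. for every s ∈ S and every t ∈ N⁻(S) \ S, both arcs (s,t) and (t,s) are present) such that the kernel network of the induced subdigraph G[S] is not fixable, then the kernel network of G is not fixable. -/
variable {V : Type*}

/-- One sequential update of the kernel network of the digraph with arc relation `E`
at vertex `v`: the state of `v` becomes `1` iff all its in-neighbours are in state `0`. -/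
def kerStep {W : Type*} [DecidableEq W] (E : W → W → Prop) (x : W → Prop) (v : W) : W → Prop :=
  Function.update x v (∀ u, E u v → ¬ x u)

/-- Sequential updates of the kernel network along the word `w`. -/
def kerWord {W : Type*} [DecidableEq W] (E : W → W → Prop) (w : List W) (x : W → Prop) : W → Prop :=
  w.foldl (kerStep E) x

/-- `x` is a fixed point of the kernel network of the digraph with arc relation `E`
(equivalently, the characteristic vector of a kernel). -/
def KerFixedPoint {W : Type*} (E : W → W → Prop) (x : W → Prop) : Prop :=
  ∀ v, x v ↔ ∀ u, E u v → ¬ x u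

/-- The kernel network of the digraph with arc relation `E` is fixable: some word fixes it. -/
def KerFixable {W : Type*} [DecidableEq W] (E : W → W → Prop) : Prop :=
  ∃ w : List W, ∀ x : W → Prop, KerFixedPoint E (kerWord E w x)

theorem kerStep_nonzero {W : Type*} [DecidableEq W] (E : W → W → Prop) (hirr : ∀ v, ¬ E v v)
    (x : W → Prop) (v : W) (hx : ∃ s, x s) : ∃ s, kerStep E x v s := by
  by_cases h : ∀ u, E u v → ¬ x u
  · exact ⟨v, by simpa [kerStep] using h⟩
  · push Not at h
    obtain ⟨u, hu, hxu⟩ := h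
    have hne : u ≠ v := by
      rintro rfl
      exact hirr _ hu
    exact ⟨u, by simpa [kerStep, hne] using hxu⟩

theorem tether_sim {V : Type*} [DecidableEq V] (E : V → V → Prop) (hirr : ∀ v, ¬ E v v)
    (S : Set V)
    (htether : ∀ s ∈ S, ∀ t, t ∉ S → (∃ s' ∈ S, E t s') → E s t ∧ E t s) (w : List V) :
    ∃ w' : List S, ∀ x : V → Prop, (∃ s : S, x s.1) →
      (∀ t, t ∉ S → (∃ s' ∈ S, E t s') → ¬ x t) →
      (∀ t, t ∉ S → (∃ s' ∈ S, E t s') → ¬ kerWord E w x t) ∧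
      (fun s : S => kerWord E w x s.1) =
        kerWord (fun a b : S => E a.1 b.1) w' (fun s : S => x s.1) := by
  induction w with
  | nil => exact ⟨[], fun x _ h => ⟨h, rfl⟩⟩
  | cons v w ih =>
    obtain ⟨w', hw'⟩ := ih
    by_cases hv : v ∈ S
    · refine ⟨⟨v, hv⟩ :: w', fun x hx hT => ?_⟩
      have key : (fun s : S => kerStep E x v s.1) =
          kerStep (fun a b : S => E a.1 b.1) (fun s : S => x s.1) ⟨v, hv⟩ := by
        funext s
        by_cases hs : s = ⟨v, hv⟩
        · subst hs
          simp only [kerStep, Function.update_self, eq_iff_iff]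
          constructor
          · intro h u hu
            exact h u.1 hu
          · intro h u hu
            by_cases huS : u ∈ S
            · exact h ⟨u, huS⟩ hu
            · exact hT u huS ⟨v, hv, hu⟩
        · have hs' : s.1 ≠ v := fun h => hs (Subtype.ext h)
          simp [kerStep, hs, hs']
      have h1 : ∃ s : S, kerStep E x v s.1 := by
        obtain ⟨s, hs⟩ := kerStep_nonzero (fun a b : S => E a.1 b.1) (fun a => hirr a.1)
          (fun s : S => x s.1) ⟨v, hv⟩ hx
        rw [← key] at hs
        exact ⟨s, hs⟩
      have h2 : ∀ t, t ∉ S → (∃ s' ∈ S, E t s') → ¬ kerStep E x v t := by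
        intro t ht hE
        have hne : t ≠ v := by
          rintro rfl
          exact ht hv
        simpa [kerStep, hne] using hT t ht hE
      obtain ⟨a, b⟩ := hw' _ h1 h2
      refine ⟨a, ?_⟩
      rw [key] at b
      exact b
    · refine ⟨w', fun x hx hT => ?_⟩
      have key : (fun s : S => kerStep E x v s.1) = (fun s : S => x s.1) := by
        funext s
        have hs' : s.1 ≠ v := fun h => hv (h ▸ s.2)
        simp [kerStep, hs']
      have h1 : ∃ s : S, kerStep E x v s.1 := by
        obtain ⟨s, hs⟩ := hx
        exact ⟨s, by rw [congrFun key s]; exact hs⟩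
      have h2 : ∀ t, t ∉ S → (∃ s' ∈ S, E t s') → ¬ kerStep E x v t := by
        intro t ht hE
        by_cases hne : t = v
        · subst hne
          obtain ⟨s, hs⟩ := hx
          have := (htether s.1 s.2 t ht hE).1
          simp only [kerStep, Function.update_self]
          exact fun h => h s.1 this hs
        · simpa [kerStep, hne] using hT t ht hE
      obtain ⟨a, b⟩ := hw' _ h1 h2
      refine ⟨a, ?_⟩
      rw [key] at b
      exact b

/-- If a finite irreflexive digraph `G` (with arc relation `E`) has a tethered set `S`
(for every `s ∈ S` and every `t ∈ N⁻(S) \ S`, both arcs `(s,t)` and `(t,s)` are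
present) such that the kernel network of the induced subdigraph `G[S]` is not fixable,
then the kernel network of `G` is not fixable. -/
theorem stmt_17 [DecidableEq V] [Fintype V] (E : V → V → Prop) (hirr : ∀ v, ¬ E v v)
    (S : Set V)
    (htether : ∀ s ∈ S, ∀ t, t ∉ S → (∃ s' ∈ S, E t s') → E s t ∧ E t s)
    (hS : ¬ KerFixable (fun a b : S => E a.1 b.1)) :
    ¬ KerFixable E := by
  rintro ⟨w, hw⟩
  apply hS
  obtain ⟨w', hw'⟩ := tether_sim E hirr S htether w
  have main : ∀ y : S → Prop, (∃ s, y s) → KerFixedPoint (fun a b : S => E a.1 b.1)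
      (kerWord (fun a b : S => E a.1 b.1) w' y) := by
    intro y hy
    let x : V → Prop := fun v => ∃ h : v ∈ S, y ⟨v, h⟩
    have hxy : (fun s : S => x s.1) = y := by
      funext s
      simp [x]
    obtain ⟨a, b⟩ := hw' x (by
      obtain ⟨s, hs⟩ := hy
      exact ⟨s, s.2, hs⟩) (fun t ht _ h => ht h.1)
    rw [hxy] at b
    rw [← b]
    intro v
    refine (hw x v.1).trans ⟨fun h u hu => h u.1 hu, fun h u hu => ?_⟩
    by_cases huS : u ∈ S
    · exact h ⟨u, huS⟩ hu
    · exact a u huS ⟨v.1, v.2, hu⟩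
  by_cases hne : Nonempty S
  · obtain ⟨s⟩ := hne
    refine ⟨s :: w', fun y => main _ ?_⟩
    by_cases hy : ∃ s, y s
    · exact kerStep_nonzero _ (fun a => hirr a.1) y s hy
    · push Not at hy
      exact ⟨s, by simp only [kerStep, Function.update_self]; exact fun u _ => hy u⟩
  · exact ⟨[], fun y v => (hne ⟨v⟩).elim⟩
end

section
/- Let G be a finite irreflexive digraph and w a word over its vertex set. Then w fixes the independent network I(G) if and only if [w] is a directed vertex cover of G, i.e. for every symmetric edge uv (both arcs present) at least one of u, v belongs to [w], and for every oriented arc (u,v) (with (v,u) not an arc) the vertex v belongs to [w]. -/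
variable {V : Type*}

/-- One sequential update of the independent network of the digraph with arc relation
`E` at vertex `v`: the state of `v` becomes `x_v ∧ ⋀_{u → v} ¬ x_u`. -/
def indStep [DecidableEq V] (E : V → V → Prop) (x : V → Prop) (v : V) : V → Prop :=
  Function.update x v (x v ∧ ∀ u, E u v → ¬ x u)

/-- Sequential updates of the independent network along the word `w`. -/
def indWord [DecidableEq V] (E : V → V → Prop) (w : List V) (x : V → Prop) : V → Prop :=
  w.foldl (indStep E) x

/-- `x` is a fixed point of the independent network (equivalently, the characteristic
vector of an independent set of the digraph). -/
def IndFixedPoint (E : V → V → Prop) (x : V → Prop) : Prop :=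
  ∀ v, x v ↔ (x v ∧ ∀ u, E u v → ¬ x u)

theorem indStep_le [DecidableEq V] (E : V → V → Prop) (x : V → Prop) (v a : V)
    (h : indStep E x v a) : x a := by
  unfold indStep at h
  by_cases hav : a = v
  · subst hav
    simp only [Function.update_self] at h
    exact h.1
  · rwa [Function.update_of_ne hav] at h

theorem indWord_le [DecidableEq V] (E : V → V → Prop) (w : List V) :
    ∀ (x : V → Prop) (a : V), indWord E w x a → x a := by
  induction w with
  | nil => intro x a h; exact h
  | cons b w ih => intro x a h; exact indStep_le E x b a (ih (indStep E x b) a h)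

theorem indWord_kill [DecidableEq V] (E : V → V → Prop) (hirr : ∀ v, ¬ E v v) (u v : V)
    (huv : E u v) (w : List V) :
    ∀ (x : V → Prop), v ∈ w → indWord E w x v → ¬ indWord E w x u := by
  induction w with
  | nil => intro x h; simp at h
  | cons b w ih =>
    intro x hv h1 h2
    by_cases hb : v = b
    · subst hb
      have h3 := indWord_le E w (indStep E x v) v h1
      have h4 := indStep_le E x v u (indWord_le E w (indStep E x v) u h2)
      unfold indStep at h3
      rw [Function.update_self] at h3
      exact h3.2 u huv h4
    · have hvw : v ∈ w := by simpa [hb] using hv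
      exact ih (indStep E x b) hvw h1 h2

theorem indWord_keep [DecidableEq V] (E : V → V → Prop) (hirr : ∀ v, ¬ E v v) (u v : V)
    (w : List V) (hv : v ∉ w) (hu : u ∉ w ∨ ¬ E v u) :
    indWord E w (fun a => a = u ∨ a = v) = fun a => a = u ∨ a = v := by
  induction w with
  | nil => rfl
  | cons b w ih =>
    have hs : indStep E (fun a => a = u ∨ a = v) b = fun a => a = u ∨ a = v := by
      unfold indStep
      rw [Function.update_eq_self_iff]
      apply propext
      constructor
      · exact fun h => h.1
      · intro h
        refine ⟨h, ?_⟩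
        rcases h with rfl | rfl
        · rintro c hc (rfl | rfl)
          · exact hirr _ hc
          · rcases hu with hu | hu
            · simp at hu
            · exact hu hc
        · simp at hv
    change indWord E w (indStep E _ b) = _
    rw [hs]
    apply ih
    · exact fun h => hv (List.mem_cons_of_mem _ h)
    · exact hu.imp (fun h h' => h (List.mem_cons_of_mem _ h')) id

/-- A word `w` fixes the independent network of a finite irreflexive digraph iff the
set of vertices occurring in `w` is a directed vertex cover: it meets every symmetric
edge, and contains the head of every oriented arc. -/
theorem stmt_18 [DecidableEq V] [Fintype V] (E : V → V → Prop) (hirr : ∀ v, ¬ E v v)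
    (w : List V) :
    (∀ x : V → Prop, IndFixedPoint E (indWord E w x)) ↔
    ((∀ u v, E u v → E v u → (u ∈ w ∨ v ∈ w)) ∧
      (∀ u v, E u v → ¬ E v u → v ∈ w)) := by
  constructor
  · intro H
    have key : ∀ u v, E u v → v ∉ w → ¬ (u ∉ w ∨ ¬ E v u) := by
      intro u v huv hv hu
      have h := H (fun a => a = u ∨ a = v)
      rw [indWord_keep E hirr u v w hv hu] at h
      exact ((h v).1 (Or.inr rfl)).2 u huv (Or.inl rfl)
    constructor
    · intro u v huv _
      by_contra hc
      exact key u v huv (fun h => hc (Or.inr h)) (Or.inl fun h => hc (Or.inl h))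
    · intro u v huv hvu
      by_contra hc
      exact key u v huv hc (Or.inr hvu)
  · rintro ⟨h1, h2⟩ x v
    refine ⟨fun hv => ⟨hv, fun u huv hu => ?_⟩, fun h => h.1⟩
    by_cases hvu : E v u
    · rcases h1 u v huv hvu with h | h
      · exact indWord_kill E hirr v u hvu w x h hu hv
      · exact indWord_kill E hirr u v huv w x h hv hu
    · exact indWord_kill E hirr u v huv w x (h2 u v huv hvu) hv hu
end

section
/- Let G be a finite irreflexive digraph and w a word over its vertex set. Then w fixes the dominating network D(G) if and only if for every benjamin m of G (a vertex m such that no vertex v satisfies N⁻[v] ⊊ N⁻[m]), the set [w] contains at least one closed twin of m, i.e. some vertex u with N⁻[u] = N⁻[m]. -/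
variable {V : Type*}

/-- One sequential update of the dominating network of the digraph with arc relation
`E` at vertex `v`: the state of `v` becomes `x_v ∨ ⋀_{u → v} ¬ x_u`. -/
def domStep [DecidableEq V] (E : V → V → Prop) (x : V → Prop) (v : V) : V → Prop :=
  Function.update x v (x v ∨ ∀ u, E u v → ¬ x u)

/-- Sequential updates of the dominating network along the word `w`. -/
def domWord [DecidableEq V] (E : V → V → Prop) (w : List V) (x : V → Prop) : V → Prop :=
  w.foldl (domStep E) x

/-- `x` is a fixed point of the dominating network (equivalently, the characteristic
vector of a dominating set of the digraph). -/
def DomFixedPoint (E : V → V → Prop) (x : V → Prop) : Prop :=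
  ∀ v, x v ↔ (x v ∨ ∀ u, E u v → ¬ x u)

/-- The closed in-neighbourhood `N⁻[v]` of `v` in the digraph with arc relation `E`. -/
def closedInNbhd (E : V → V → Prop) (v : V) : Set V :=
  insert v {u | E u v}

theorem domStep_mono [DecidableEq V] (E : V → V → Prop) (x : V → Prop) (v a : V) (h : x a) :
    domStep E x v a := by
  unfold domStep
  by_cases hav : a = v
  · subst hav
    simp [h]
  · simpa [hav] using h

theorem domWord_mono [DecidableEq V] (E : V → V → Prop) (w : List V) :
    ∀ (x : V → Prop) (a : V), x a → domWord E w x a := by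
  induction w with
  | nil => intro x a h; exact h
  | cons v w ih => intro x a h; exact ih _ a (domStep_mono E x v a h)

theorem domStep_hit [DecidableEq V] (E : V → V → Prop) (x : V → Prop) (v : V) :
    ∃ a ∈ closedInNbhd E v, domStep E x v a := by
  by_cases h : ∃ a, E a v ∧ x a
  · obtain ⟨a, ha, hx⟩ := h
    exact ⟨a, Or.inr ha, domStep_mono E x v a hx⟩
  · refine ⟨v, Or.inl rfl, ?_⟩
    have h2 : x v ∨ ∀ u, E u v → ¬ x u := Or.inr fun u hu hx => h ⟨u, hu, hx⟩
    simpa [domStep] using h2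

theorem domWord_hit [DecidableEq V] (E : V → V → Prop) (w : List V) :
    ∀ (x : V → Prop) (v : V), v ∈ w → ∃ a ∈ closedInNbhd E v, domWord E w x a := by
  induction w with
  | nil => intro x v h; simp at h
  | cons b w ih =>
    intro x v h
    rcases List.mem_cons.1 h with rfl | h
    · obtain ⟨a, ha, hx⟩ := domStep_hit E x v
      exact ⟨a, ha, domWord_mono E w _ a hx⟩
    · exact ih _ v h

theorem domStep_eq [DecidableEq V] (E : V → V → Prop) (x : V → Prop) (v : V)
    (h : ∃ a ∈ closedInNbhd E v, x a) : domStep E x v = x := by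
  unfold domStep
  rw [Function.update_eq_self_iff]
  refine propext ⟨?_, Or.inl⟩
  rintro (h1 | h1)
  · exact h1
  · obtain ⟨a, ha | ha, hx⟩ := h
    · exact ha ▸ hx
    · exact absurd hx (h1 a ha)

theorem domWord_eq [DecidableEq V] (E : V → V → Prop) (x : V → Prop) (w : List V)
    (h : ∀ v ∈ w, ∃ a ∈ closedInNbhd E v, x a) : domWord E w x = x := by
  induction w with
  | nil => rfl
  | cons b w ih =>
    have h1 := domStep_eq E x b (h b (by simp))
    have h2 := ih fun v hv => h v (by simp [hv])
    unfold domWord at h2 ⊢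
    rw [List.foldl_cons, h1, h2]

theorem exists_benjamin [Fintype V] (E : V → V → Prop) (v : V) :
    ∃ m, closedInNbhd E m ⊆ closedInNbhd E v ∧
      ¬ ∃ u, closedInNbhd E u ⊂ closedInNbhd E m := by
  have wf : WellFounded fun a b : V => closedInNbhd E a ⊂ closedInNbhd E b :=
    InvImage.wf (closedInNbhd E) (wellFounded_lt (α := Set V))
  induction v using wf.induction with
  | _ v ih =>
    by_cases h : ∃ u, closedInNbhd E u ⊂ closedInNbhd E v
    · obtain ⟨u, hu⟩ := h
      obtain ⟨m, hm, hb⟩ := ih u hu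
      exact ⟨m, hm.trans hu.subset, hb⟩
    · exact ⟨v, subset_rfl, h⟩

/-- A word `w` fixes the dominating network of a finite irreflexive digraph iff for
every benjamin `m` (no vertex `v` has `N⁻[v] ⊊ N⁻[m]`), the word `w` contains a closed
twin of `m` (some `u` with `N⁻[u] = N⁻[m]`). -/
theorem stmt_19 [DecidableEq V] [Fintype V] (E : V → V → Prop) (hirr : ∀ v, ¬ E v v)
    (w : List V) :
    (∀ x : V → Prop, DomFixedPoint E (domWord E w x)) ↔
    (∀ m : V, (¬ ∃ v, closedInNbhd E v ⊂ closedInNbhd E m) →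
      ∃ u ∈ w, closedInNbhd E u = closedInNbhd E m) := by
  constructor
  · intro H m hm
    by_contra hw
    have hfix : domWord E w (fun a => a ∉ closedInNbhd E m) = fun a => a ∉ closedInNbhd E m := by
      apply domWord_eq
      intro v hv
      by_contra hc
      have hsub : closedInNbhd E v ⊆ closedInNbhd E m := by
        intro a ha
        by_contra hn
        exact hc ⟨a, ha, hn⟩
      rcases hsub.eq_or_ssubset with he | hs
      · exact hw ⟨v, hv, he⟩
      · exact hm ⟨v, hs⟩
    have h1 := H (fun a => a ∉ closedInNbhd E m)
    rw [hfix] at h1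
    exact (h1 m).2 (Or.inr fun u hu hn => hn (Or.inr hu)) (Or.inl rfl)
  · intro H x v
    refine ⟨Or.inl, ?_⟩
    rintro (h | h)
    · exact h
    obtain ⟨m, hm, hb⟩ := exists_benjamin E v
    obtain ⟨u, hu, he⟩ := H m hb
    obtain ⟨a, ha, hx⟩ := domWord_hit E w x u hu
    rcases hm (he ▸ ha) with hav | hav
    · exact hav ▸ hx
    · exact absurd hx (h a hav)
end
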